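/- Let (M, τ) be a tracial W*-probability space, B ⊂ M a unital *-subalgebra, and X_1,…,X_n ∈ M selfadjoint with χ*(X_1,…,X_n : B) > −∞. Let D ⊂ B be a finite-dimensional unital *-subalgebra of B with a conditional expectation E: M → D such that τ∘E = τ. Then the following are equivalent: (i) χ*(X_1,…,X_n : B) = χ*(X_1,…,X_n : D); (ii) {X_1,…,X_n} is free from B with amalgamation over D. -/

import Mathlib

/-!  Statement 19 (Theorem 6.5):  for finite-dimensional `D ⊆ B` and selfadjoint `X₁,…,Xₙ` with `χ*(X₁,…,Xₙ : B) > −∞`, one has `χ*(X₁,…,Xₙ : B) = χ*(X₁,…,Xₙ : D)` iff `{X₁,…,Xₙ}` is free from `B` with amalgamation over `D`.  The relative free entropy `χ*` is defined through a family `S₁,…,Sₙ` of `(0,1)`-semicircular elements free from `B⟨X₁,…,Xₙ⟩` (and from each other). -/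

open scoped Classical ENNReal

noncomputable section

namespace OVD

variable {M : Type*} [Ring M] [Algebra ℂ M] [StarRing M] [StarModule ℂ M]

/-- `τ` is a faithful tracial state on the complex `*`-algebra `M`
(the normality and von Neumann algebra structure of a tracial
`W*`-probability space are not used in the algebraic statement). -/
structure IsFaithfulTracialState [StarRing M] (τ : M →ₗ[ℂ] ℂ) : Prop where
  unital : τ 1 = 1
  tracial : ∀ x y, τ (x * y) = τ (y * x)
  pos : ∀ x, 0 ≤ (τ (star x * x)).re ∧ (τ (star x * x)).im = 0
  faithful : ∀ x, τ (star x * x) = 0 → x = 0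

/-- `E : M → M` is a conditional expectation onto the unital subalgebra `B`. -/
def IsCondExp (B : Subalgebra ℂ M) (E : M →ₗ[ℂ] M) : Prop :=
  E 1 = 1 ∧ (∀ x, E x ∈ B) ∧ ∀ b ∈ B, ∀ b' ∈ B, ∀ x, E (b * x * b') = b * E x * b'

/-- Two subsets `S₁, S₂` of `A` (each thought of as a subalgebra containing the
base algebra) are free with amalgamation with respect to the conditional
expectation `E` (valued in the module `W`):  every alternating product of
`E`-centered elements is `E`-centered. -/
def IsFreeWithAmalgamation {A W : Type*} [Ring A] [Algebra ℂ A]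
    [AddCommGroup W] [Module ℂ W] (E : A →ₗ[ℂ] W) (S₁ S₂ : Set A) : Prop :=
  ∀ (k : ℕ), 0 < k → ∀ (a : Fin k → A) (f : Fin k → Bool),
    (∀ j, a j ∈ (if f j then S₁ else S₂)) →
    (∀ j, E (a j) = 0) →
    (∀ (j : ℕ) (h : j + 1 < k), f ⟨j, Nat.lt_of_succ_lt h⟩ ≠ f ⟨j + 1, h⟩) →
    E ((List.ofFn a).prod) = 0

/-- the `L²`-distance with respect to the trace `τ`: `‖x − y‖₂`. -/
def l2Dist [StarRing M] (τ : M →ₗ[ℂ] ℂ) (x y : M) : ℝ :=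
  Real.sqrt ((τ ((x - y) * star (x - y))).re)

/-- `x` belongs to `L²(S)`, the `‖·‖₂`-closure of the (star-)algebra
generated by `S`, (intersected with `M`; conjugate variables and liberation
gradients are modelled as elements of `M` here). -/
def MemL2Closure [StarRing M] (τ : M →ₗ[ℂ] ℂ) (S : Set M) (x : M) : Prop :=
  ∀ ε : ℝ, 0 < ε → ∃ a ∈ Algebra.adjoin ℂ (S ∪ star '' S), l2Dist τ x a < ε

/-- the word `b₁ X_{i₁} b₂ X_{i₂} ⋯ b_m X_{i_m} b_{m+1}`. -/
def altWord {n : ℕ} (X : Fin n → M) {m : ℕ} (b : Fin (m + 1) → M)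
    (idx : Fin m → Fin n) : M :=
  (List.ofFn fun j : Fin m => b j.castSucc * X (idx j)).prod * b (Fin.last m)

/-- the initial segment `b₁ X_{i₁} ⋯ b_{r-1} X_{i_{r-1}} b_r` of an
alternating word (`r` is `0`-indexed). -/
def altWordBefore {n : ℕ} (X : Fin n → M) {m : ℕ} (b : Fin (m + 1) → M)
    (idx : Fin m → Fin n) (r : Fin m) : M :=
  (((List.finRange m).filter fun s : Fin m => decide ((s : ℕ) < (r : ℕ))).map
      fun j => b j.castSucc * X (idx j)).prod * b r.castSucc

/-- the final segment `b_{r+1} X_{i_{r+1}} ⋯ b_m X_{i_m} b_{m+1}` of an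
alternating word (`r` is `0`-indexed). -/
def altWordAfter {n : ℕ} (X : Fin n → M) {m : ℕ} (b : Fin (m + 1) → M)
    (idx : Fin m → Fin n) (r : Fin m) : M :=
  (((List.finRange m).filter fun s : Fin m => decide ((r : ℕ) < (s : ℕ))).map
      fun j => b j.castSucc * X (idx j)).prod * b (Fin.last m)

/-- the defining equations of the conjugate variables `J_i = J_i(X₁,…,Xₙ : B)`:
`τ(J_i b₁ X_{i₁} ⋯ b_m X_{i_m} b_{m+1}) = ∑_r δ_{i i_r} τ(b₁ X_{i₁} ⋯ b_r) ·
τ(b_{r+1} X_{i_{r+1}} ⋯ b_{m+1})` for all `m ≥ 0` and `b₁,…,b_{m+1} ∈ B`. -/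
def ConjugateEquations (τ : M →ₗ[ℂ] ℂ) (B : Subalgebra ℂ M) {n : ℕ}
    (X J : Fin n → M) : Prop :=
  ∀ (i : Fin n) (m : ℕ) (b : Fin (m + 1) → M) (idx : Fin m → Fin n),
    (∀ j, b j ∈ B) →
    τ (J i * altWord X b idx) =
      ∑ r : Fin m, (if idx r = i then (1 : ℂ) else 0) *
        τ (altWordBefore X b idx r) * τ (altWordAfter X b idx r)

/-- `J` is the system of conjugate variables of `X₁,…,Xₙ` with respect to `B`. -/
def IsConjugateSystem [StarRing M] (τ : M →ₗ[ℂ] ℂ) (B : Subalgebra ℂ M) {n : ℕ}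
    (X J : Fin n → M) : Prop :=
  (∀ i, MemL2Closure τ ((B : Set M) ∪ Set.range X) (J i)) ∧
    ConjugateEquations τ B X J

/-- the relative free Fisher information `Φ*(X₁,…,Xₙ : B)`; it equals
`∑ᵢ ‖Jᵢ‖₂²` if a conjugate system `J` exists and `∞` otherwise. -/
def phiStar [StarRing M] (τ : M →ₗ[ℂ] ℂ) (B : Subalgebra ℂ M) {n : ℕ}
    (X : Fin n → M) : ℝ≥0∞ :=
  sInf {r : ℝ≥0∞ | ∃ J : Fin n → M, IsConjugateSystem τ B X J ∧
    r = ∑ i, ENNReal.ofReal ((τ (J i * star (J i))).re)}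

/-- a family of subalgebras of `M` is free with respect to the trace `τ`:
alternating products of centered elements are centered. -/
def IsFreeFamily {ι : Type*} (τ : M →ₗ[ℂ] ℂ) (A : ι → Subalgebra ℂ M) : Prop :=
  ∀ (k : ℕ), 0 < k → ∀ (a : Fin k → M) (f : Fin k → ι),
    (∀ j, a j ∈ A (f j)) → (∀ j, τ (a j) = 0) →
    (∀ (j : ℕ) (h : j + 1 < k), f ⟨j, Nat.lt_of_succ_lt h⟩ ≠ f ⟨j + 1, h⟩) →
    τ ((List.ofFn a).prod) = 0

/-- `S` is a `(0,1)`-semicircular element with respect to `τ`. -/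
def IsStandardSemicircular (τ : M →ₗ[ℂ] ℂ) (S : M) : Prop :=
  IsSelfAdjoint S ∧ (∀ p : ℕ, τ (S ^ (2 * p)) = (catalan p : ℂ)) ∧
    ∀ p : ℕ, τ (S ^ (2 * p + 1)) = 0

/-- the relative free entropy
`χ*(X₁,…,Xₙ : B) = ½ ∫₀^∞ ( n/(1+t) − Φ*(X₁+√t S₁,…,Xₙ+√t Sₙ : B) ) dt
+ (n/2) log(2πe)`, computed with a given `(0,1)`-semicircular family `S` free
from `B⟨X₁,…,Xₙ⟩`; it is `−∞` unless the integrand is (finite and)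
integrable. -/
def chiStar (τ : M →ₗ[ℂ] ℂ) (B : Subalgebra ℂ M) {n : ℕ}
    (X S : Fin n → M) : EReal :=
  if (∀ t ∈ Set.Ioi (0 : ℝ),
        phiStar τ B (fun i => X i + (Real.sqrt t : ℂ) • S i) ≠ ⊤) ∧
      MeasureTheory.IntegrableOn
        (fun t : ℝ => (n : ℝ) / (1 + t) -
          (phiStar τ B fun i => X i + (Real.sqrt t : ℂ) • S i).toReal)
        (Set.Ioi 0)
  then (((1 / 2 : ℝ) * (∫ t in Set.Ioi (0 : ℝ),
          ((n : ℝ) / (1 + t) -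
            (phiStar τ B fun i => X i + (Real.sqrt t : ℂ) • S i).toReal)) +
        (n / 2 : ℝ) * Real.log (2 * Real.pi * Real.exp 1) : ℝ) : EReal)
  else (⊥ : EReal)

set_option linter.unusedSectionVars false

/-! ### Faithful tracial states -/

namespace IsFaithfulTracialState

variable {τ : M →ₗ[ℂ] ℂ}

theorem apply_star (hτ : IsFaithfulTracialState τ) (x : M) :
    τ (star x) = (starRingEnd ℂ) (τ x) := by
  have h0 := (hτ.pos x).2
  have h1 := (hτ.pos (x + 1)).2
  have h2 := (hτ.pos (x + Complex.I • 1)).2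
  simp only [star_add, star_one, mul_add, add_mul, mul_one, one_mul, map_add, hτ.unital,
    star_smul, smul_mul_assoc, mul_smul_comm, map_smul, smul_eq_mul, Complex.add_im,
    Complex.one_im, Complex.mul_im, Complex.I_re, Complex.I_im, Complex.star_def,
    Complex.conj_I, Complex.neg_re, Complex.neg_im] at h0 h1 h2
  apply Complex.ext
  · simp only [Complex.conj_re]
    linarith
  · simp only [Complex.conj_im]
    linarith

theorem apply_mul_star (hτ : IsFaithfulTracialState τ) (x y : M) :
    τ (x * star y) = (starRingEnd ℂ) (τ (y * star x)) := by
  rw [← hτ.apply_star, star_mul, star_star]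

theorem re_apply_self_nonneg (hτ : IsFaithfulTracialState τ) (x : M) :
    0 ≤ (τ (x * star x)).re := by
  rw [hτ.tracial]
  exact (hτ.pos x).1

theorem eq_zero_of_re (hτ : IsFaithfulTracialState τ) {x : M}
    (h : (τ (x * star x)).re = 0) : x = 0 := by
  apply hτ.faithful
  rw [hτ.tracial] at h
  exact Complex.ext h (hτ.pos x).2

theorem norm_apply_mul_le (hτ : IsFaithfulTracialState τ) (x y : M) :
    ‖τ (x * y)‖ ≤ √(τ (x * star x)).re * √(τ (star y * y)).re := by
  let c : PreInnerProductSpace.Core ℂ M :=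
    { inner := fun x y => τ (star x * y)
      conj_inner_symm := fun x y => by
        rw [← hτ.apply_star, star_mul, star_star]
      re_inner_nonneg := fun x => (hτ.pos x).1
      add_left := fun x y z => by simp [add_mul]
      smul_left := fun x y r => by simp }
  have h := @InnerProductSpace.Core.norm_inner_le_norm ℂ M _ _ _ c (star x) y
  have e1 : @inner ℂ M c.toInner (star x) y = τ (x * y) := by
    change τ (star (star x) * y) = _
    rw [star_star]
  rw [e1] at h
  refine h.trans_eq ?_
  change √(τ (star (star x) * star x)).re * √(τ (star y * y)).re = _
  rw [star_star]

end IsFaithfulTracialState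

theorem MemL2Closure.apply_mul_eq_zero {τ : M →ₗ[ℂ] ℂ} (hτ : IsFaithfulTracialState τ)
    {S : Set M} {x z : M} (hx : MemL2Closure τ S x)
    (hz : ∀ a ∈ Algebra.adjoin ℂ (S ∪ star '' S), τ (a * z) = 0) : τ (x * z) = 0 := by
  by_contra hne
  set C := √(τ (star z * z)).re with hC
  have hpos : 0 < ‖τ (x * z)‖ := norm_pos_iff.mpr hne
  have hC0 : 0 ≤ C := Real.sqrt_nonneg _
  obtain ⟨a, ha, hd⟩ := hx (‖τ (x * z)‖ / (C + 1)) (by positivity)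
  have h1 : τ (x * z) = τ ((x - a) * z) := by rw [sub_mul, map_sub, hz a ha, sub_zero]
  have h2 := hτ.norm_apply_mul_le (x - a) z
  rw [← h1] at h2
  change _ ≤ l2Dist τ x a * C at h2
  rw [lt_div_iff₀ (by positivity)] at hd
  have h3 : 0 ≤ l2Dist τ x a := Real.sqrt_nonneg _
  nlinarith

/-! ### The polynomial algebra of a tuple over a base algebra -/

/-- The algebra `B⟨Y₁, …, Yₙ⟩` generated by `B` and the entries of `Y`. -/
abbrev polyAlg (B : Subalgebra ℂ M) {n : ℕ} (Y : Fin n → M) : Subalgebra ℂ M :=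
  B ⊔ Algebra.adjoin ℂ (Set.range Y)

theorem polyAlg_eq_adjoin (B : Subalgebra ℂ M) {n : ℕ} (Y : Fin n → M) :
    polyAlg B Y = Algebra.adjoin ℂ ((B : Set M) ∪ Set.range Y) := by
  rw [Algebra.adjoin_union, Algebra.adjoin_eq]

theorem adjoin_union_star_eq {B : Subalgebra ℂ M} (hB : ∀ b ∈ B, star b ∈ B) {n : ℕ}
    {Y : Fin n → M} (hY : ∀ i, IsSelfAdjoint (Y i)) :
    Algebra.adjoin ℂ (((B : Set M) ∪ Set.range Y) ∪ star '' ((B : Set M) ∪ Set.range Y)) =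
      polyAlg B Y := by
  rw [polyAlg_eq_adjoin]
  congr 1
  apply Set.union_eq_left.mpr
  rintro _ ⟨x, hx | ⟨i, rfl⟩, rfl⟩
  · exact Or.inl (hB x hx)
  · exact Or.inr ⟨i, (hY i).star_eq.symm⟩

theorem star_mem_polyAlg {B : Subalgebra ℂ M} (hB : ∀ b ∈ B, star b ∈ B) {n : ℕ}
    {Y : Fin n → M} (hY : ∀ i, IsSelfAdjoint (Y i)) {x : M} (hx : x ∈ polyAlg B Y) :
    star x ∈ polyAlg B Y := by
  rw [polyAlg_eq_adjoin] at hx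
  induction hx using Algebra.adjoin_induction with
  | mem x h =>
    rcases h with h | ⟨i, rfl⟩
    · exact (le_sup_left : B ≤ _) (hB x h)
    · rw [(hY i).star_eq, polyAlg_eq_adjoin]; exact Algebra.subset_adjoin (Or.inr ⟨i, rfl⟩)
  | algebraMap r =>
    rw [Algebra.algebraMap_eq_smul_one, star_smul, star_one]
    exact Subalgebra.smul_mem _ (one_mem _) _
  | add x y hx hy ihx ihy =>
    rw [star_add]; exact add_mem ihx ihy
  | mul x y hx hy ihx ihy =>
    rw [star_mul]; exact mul_mem ihy ihx

theorem mem_polyAlg_var (B : Subalgebra ℂ M) {n : ℕ} (Y : Fin n → M) (i : Fin n) :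
    Y i ∈ polyAlg B Y :=
  (le_sup_right : _ ≤ polyAlg B Y) (Algebra.subset_adjoin ⟨i, rfl⟩)

theorem mem_polyAlg_base {B : Subalgebra ℂ M} {n : ℕ} (Y : Fin n → M) {b : M} (hb : b ∈ B) :
    b ∈ polyAlg B Y :=
  (le_sup_left : B ≤ polyAlg B Y) hb

theorem polyAlg_mono {D B : Subalgebra ℂ M} (h : D ≤ B) {n : ℕ} (Y : Fin n → M) :
    polyAlg D Y ≤ polyAlg B Y :=
  sup_le_sup_right h _

/-! ### Conditional expectations onto a subalgebra -/

section CondExp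

variable {D : Subalgebra ℂ M} {E : M →ₗ[ℂ] M}

theorem IsCondExp.apply_of_mem (hE : IsCondExp D E) {d : M} (hd : d ∈ D) : E d = d := by
  have := hE.2.2 d hd 1 (one_mem _) 1
  simpa [hE.1] using this

theorem IsCondExp.apply_mul_left (hE : IsCondExp D E) {d : M} (hd : d ∈ D) (x : M) :
    E (d * x) = d * E x := by
  have := hE.2.2 d hd 1 (one_mem _) x
  simpa using this

theorem IsCondExp.apply_mul_right (hE : IsCondExp D E) {d : M} (hd : d ∈ D) (x : M) :
    E (x * d) = E x * d := by
  have := hE.2.2 1 (one_mem _) d hd x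
  simpa using this

theorem IsCondExp.apply_sub_self (hE : IsCondExp D E) (x : M) : E (x - E x) = 0 := by
  rw [map_sub, hE.apply_of_mem (hE.2.1 x), sub_self]

variable {τ : M →ₗ[ℂ] ℂ}

theorem IsCondExp.apply_eq_zero_iff (hτ : IsFaithfulTracialState τ)
    (hD : ∀ d ∈ D, star d ∈ D) (hE : IsCondExp D E) (hEτ : ∀ x, τ (E x) = τ x) {x : M} :
    E x = 0 ↔ ∀ d ∈ D, τ (d * x) = 0 := by
  constructor
  · intro h d hd
    rw [← hEτ, hE.apply_mul_left hd, h, mul_zero, map_zero]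
  · intro h
    apply hτ.faithful
    rw [← hE.apply_mul_left (hD _ (hE.2.1 x)), hEτ]
    exact h _ (hD _ (hE.2.1 x))

theorem IsCondExp.apply_star_eq_zero (hτ : IsFaithfulTracialState τ)
    (hD : ∀ d ∈ D, star d ∈ D) (hE : IsCondExp D E) (hEτ : ∀ x, τ (E x) = τ x) {x : M}
    (hx : E x = 0) : E (star x) = 0 := by
  rw [IsCondExp.apply_eq_zero_iff hτ hD hE hEτ] at hx ⊢
  intro d hd
  rw [hτ.apply_mul_star, hτ.tracial, hx _ (hD d hd), map_zero]

/-- A finite-dimensional subalgebra has a pair of dual families for the trace. -/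
theorem exists_dual_families (hτ : IsFaithfulTracialState τ) [FiniteDimensional ℂ D]
    (hD : ∀ d ∈ D, star d ∈ D) :
    ∃ (m : ℕ) (p q : Fin m → M), (∀ k, p k ∈ D) ∧ (∀ k, q k ∈ D) ∧
      ∀ z ∈ D, z = ∑ k, τ (z * p k) • q k := by
  let β : LinearMap.BilinForm ℂ D :=
    LinearMap.mk₂ ℂ (fun x y : D => τ ((x : M) * y)) (by simp [add_mul]) (by simp)
      (by simp [mul_add]) (by simp)
  have hβ : β.Nondegenerate := by
    have hs : ∀ x : D, (∀ y : D, τ ((x : M) * y) = 0) → x = 0 := fun x hx => by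
      refine Subtype.ext (hτ.faithful _ ?_)
      rw [hτ.tracial]
      exact hx ⟨star (x : M), hD _ x.2⟩
    exact ⟨hs, fun x hx => hs x fun y => (hτ.tracial _ _).trans (hx y)⟩
  let b := Module.finBasis ℂ D
  refine ⟨_, fun k => (b k : M), fun k => (β.dualBasis hβ b k : M), fun k => (b k).2,
    fun k => (β.dualBasis hβ b k).2, fun z hz => ?_⟩
  have h := (β.dualBasis hβ b).sum_repr ⟨z, hz⟩
  simp only [LinearMap.BilinForm.dualBasis_repr_apply] at h
  have h' := congrArg (Subtype.val : D → M) h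
  rw [AddSubmonoidClass.coe_finsetSum] at h'
  exact h'.symm

end CondExp

/-! ### Alternating words of centered letters -/

section Words

variable {ι W : Type*} [AddCommGroup W] [Module ℂ W]

/-- The product of the letters of a labelled word. -/
def wordProd (l : List (ι × M)) : M := (l.map Prod.snd).prod

@[simp] theorem wordProd_nil : wordProd ([] : List (ι × M)) = 1 := rfl

@[simp] theorem wordProd_cons (p : ι × M) (l : List (ι × M)) :
    wordProd (p :: l) = p.2 * wordProd l := by simp [wordProd]

@[simp] theorem wordProd_append (l l' : List (ι × M)) :
    wordProd (l ++ l') = wordProd l * wordProd l' := by simp [wordProd]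

/-- An alternating word of `φ`-centered letters from the algebras `P i`. -/
structure IsAlt (φ : M →ₗ[ℂ] W) (P : ι → Subalgebra ℂ M) (l : List (ι × M)) : Prop where
  mem : ∀ p ∈ l, p.2 ∈ P p.1
  centered : ∀ p ∈ l, φ p.2 = 0
  chain : l.IsChain fun p q => p.1 ≠ q.1

/-- Freeness of a family of algebras with respect to `φ`, in terms of words. -/
def WordFree (φ : M →ₗ[ℂ] W) (P : ι → Subalgebra ℂ M) : Prop :=
  ∀ l : List (ι × M), l ≠ [] → IsAlt φ P l → φ (wordProd l) = 0

variable {φ : M →ₗ[ℂ] W} {P : ι → Subalgebra ℂ M}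

theorem isAlt_nil : IsAlt φ P [] := ⟨by simp, by simp, by simp⟩

theorem isAlt_cons_iff {p : ι × M} {l : List (ι × M)} :
    IsAlt φ P (p :: l) ↔
      p.2 ∈ P p.1 ∧ φ p.2 = 0 ∧ (∀ q ∈ l.head?, p.1 ≠ q.1) ∧ IsAlt φ P l := by
  constructor
  · rintro ⟨h1, h2, h3⟩
    rw [List.isChain_cons] at h3
    exact ⟨h1 p (by simp), h2 p (by simp), h3.1,
      fun q hq => h1 q (by simp [hq]), fun q hq => h2 q (by simp [hq]), h3.2⟩
  · rintro ⟨h1, h2, h3, h4⟩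
    refine ⟨?_, ?_, List.isChain_cons.2 ⟨h3, h4.chain⟩⟩
    · rintro q (_ | ⟨_, hq⟩)
      exacts [h1, h4.mem q hq]
    · rintro q (_ | ⟨_, hq⟩)
      exacts [h2, h4.centered q hq]

theorem isAlt_append_iff {l l' : List (ι × M)} :
    IsAlt φ P (l ++ l') ↔
      IsAlt φ P l ∧ IsAlt φ P l' ∧ ∀ p ∈ l.getLast?, ∀ q ∈ l'.head?, p.1 ≠ q.1 := by
  constructor
  · rintro ⟨h1, h2, h3⟩
    rw [List.isChain_append] at h3
    exact ⟨⟨fun q hq => h1 q (by simp [hq]), fun q hq => h2 q (by simp [hq]), h3.1⟩,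
      ⟨fun q hq => h1 q (by simp [hq]), fun q hq => h2 q (by simp [hq]), h3.2.1⟩, h3.2.2⟩
  · rintro ⟨h1, h2, h3⟩
    refine ⟨fun q hq => ?_, fun q hq => ?_, List.isChain_append.2 ⟨h1.chain, h2.chain, h3⟩⟩
    · exact (List.mem_append.1 hq).elim (h1.mem q) (h2.mem q)
    · exact (List.mem_append.1 hq).elim (h1.centered q) (h2.centered q)

theorem wordFree_iff_ofFn :
    WordFree φ P ↔ ∀ (k : ℕ), 0 < k → ∀ (a : Fin k → M) (f : Fin k → ι),
      (∀ j, a j ∈ P (f j)) → (∀ j, φ (a j) = 0) →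
      (∀ (j : ℕ) (h : j + 1 < k), f ⟨j, Nat.lt_of_succ_lt h⟩ ≠ f ⟨j + 1, h⟩) →
      φ ((List.ofFn a).prod) = 0 := by
  constructor
  · intro H k hk a f h1 h2 h3
    have := H (List.ofFn fun j => (f j, a j)) (by simp; omega) ⟨?_, ?_, ?_⟩
    · simpa [wordProd, List.map_ofFn, Function.comp_def] using this
    · simpa [List.mem_ofFn] using h1
    · simpa [List.mem_ofFn] using h2
    · rw [List.isChain_iff_getElem]
      intro j hj
      simpa using h3 j (by simpa using hj)
  · intro H l hl hA
    have := H l.length (List.length_pos_iff.2 hl) (fun j => (l.get j).2) (fun j => (l.get j).1)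
      (fun j => hA.mem _ (l.get_mem _)) (fun j => hA.centered _ (l.get_mem _))
      (fun j h => (List.isChain_iff_getElem.1 hA.chain) j h)
    rw [← this, wordProd]
    congr 2
    apply List.ext_getElem <;> simp

end Words

/-- The pair of algebras `A`, `B` as a family indexed by `Bool`. -/
def pairAlg (A B : Subalgebra ℂ M) (f : Bool) : Subalgebra ℂ M := if f then A else B

@[simp] theorem pairAlg_true (A B : Subalgebra ℂ M) : pairAlg A B true = A := rfl

@[simp] theorem pairAlg_false (A B : Subalgebra ℂ M) : pairAlg A B false = B := rfl

theorem isFreeWithAmalgamation_iff {E : M →ₗ[ℂ] M} {A B : Subalgebra ℂ M} :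
    IsFreeWithAmalgamation E (A : Set M) (B : Set M) ↔ WordFree E (pairAlg A B) := by
  rw [wordFree_iff_ofFn]
  have key : ∀ (b : Bool) (x : M),
      x ∈ (if b then (A : Set M) else (B : Set M)) ↔ x ∈ pairAlg A B b := by
    rintro (_ | _) x <;> simp
  unfold IsFreeWithAmalgamation
  simp only [key]

/-! ### Alternating words over a conditional expectation -/

section Amalgam

variable {D A B : Subalgebra ℂ M} {E : M →ₗ[ℂ] M} {τ : M →ₗ[ℂ] ℂ}

/-- Some letter of the word is labelled `false`. -/
def HasFalse (l : List (Bool × M)) : Prop := ∃ p ∈ l, p.1 = false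

theorem pairAlg_base_le (hA : D ≤ A) (hB : D ≤ B) (f : Bool) : D ≤ pairAlg A B f := by
  cases f <;> assumption

theorem wordFree_of_trace (hτ : IsFaithfulTracialState τ)
    (hD : ∀ d ∈ D, star d ∈ D) (hE : IsCondExp D E) (hEτ : ∀ x, τ (E x) = τ x)
    (hDA : D ≤ A) (hDB : D ≤ B) {l : List (Bool × M)} (hl : l ≠ [])
    (hA : IsAlt E (pairAlg A B) l)
    (H : ∀ l' : List (Bool × M), l'.length = l.length → IsAlt E (pairAlg A B) l' →
      τ (wordProd l') = 0) : E (wordProd l) = 0 := by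
  rw [IsCondExp.apply_eq_zero_iff hτ hD hE hEτ]
  intro d hd
  obtain ⟨p, l, rfl⟩ := List.exists_cons_of_ne_nil hl
  rw [isAlt_cons_iff] at hA
  have := H ((p.1, d * p.2) :: l) (by simp) (isAlt_cons_iff.2
    ⟨mul_mem (pairAlg_base_le hDA hDB _ hd) hA.1,
      by rw [hE.apply_mul_left hd, hA.2.1, mul_zero], hA.2.2.1, hA.2.2.2⟩)
  simpa [mul_assoc] using this

/-- Centering the first letter of a word, at the cost of a term with the letter removed. -/
theorem WordFree.apply_mul_eq_zero (hE : IsCondExp D E) (hDA : D ≤ A) (hDB : D ≤ B)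
    (hF : WordFree E (pairAlg A B)) {f : Bool} {x : M} (hx : x ∈ pairAlg A B f)
    {l : List (Bool × M)} (hl : l ≠ []) (hA : IsAlt E (pairAlg A B) l)
    (hh : ∀ q ∈ l.head?, f ≠ q.1) : E (x * wordProd l) = 0 := by
  have h1 := hF ((f, x - E x) :: l) (by simp) (isAlt_cons_iff.2
    ⟨sub_mem hx (pairAlg_base_le hDA hDB _ (hE.2.1 x)), hE.apply_sub_self x, hh, hA⟩)
  rw [wordProd_cons, sub_mul, map_sub, hE.apply_mul_left (hE.2.1 x), hF l hl hA, mul_zero,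
    sub_zero] at h1
  exact h1

theorem WordFree.apply_mul_hasFalse (hE : IsCondExp D E) (hDA : D ≤ A) (hDB : D ≤ B)
    (hF : WordFree E (pairAlg A B)) {l : List (Bool × M)} (hA : IsAlt E (pairAlg A B) l)
    (hf : HasFalse l) {a : M} (ha : a ∈ A) : E (a * wordProd l) = 0 := by
  obtain ⟨p, hp, hpf⟩ := hf
  rcases l with _ | ⟨⟨f, x⟩, l⟩
  · simp at hp
  · cases f
    · exact hF.apply_mul_eq_zero hE hDA hDB (f := true) ha (by simp) hA (by simp)
    · have h := isAlt_cons_iff.1 hA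
      have hl : l ≠ [] := by
        rintro rfl
        simp only [List.mem_singleton] at hp
        simp [hp] at hpf
      rw [wordProd_cons, ← mul_assoc]
      exact hF.apply_mul_eq_zero hE hDA hDB (f := true) (mul_mem ha h.1) hl h.2.2.2 h.2.2.1

theorem WordFree.trace_mul_mul (hτ : IsFaithfulTracialState τ) (hE : IsCondExp D E)
    (hEτ : ∀ x, τ (E x) = τ x) (hDA : D ≤ A) (hDB : D ≤ B)
    (hF : WordFree E (pairAlg A B)) {l : List (Bool × M)} (hA : IsAlt E (pairAlg A B) l)
    (hf : HasFalse l) {a a' : M} (ha : a ∈ A) (ha' : a' ∈ A) :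
    τ (a * wordProd l * a') = 0 := by
  rw [hτ.tracial, ← mul_assoc, ← hEτ, hF.apply_mul_hasFalse hE hDA hDB hA hf (mul_mem ha' ha),
    map_zero]

/-- The span of the alternating centered words, together with the base algebra, is stable under
left multiplication by letters. -/
theorem mul_mem_altSpan (hE : IsCondExp D E) (hDA : D ≤ A) (hDB : D ≤ B) {f : Bool} {x : M}
    (hx : x ∈ pairAlg A B f) {u : M}
    (hu : u ∈ Subalgebra.toSubmodule D ⊔
      Submodule.span ℂ {w | ∃ l, IsAlt E (pairAlg A B) l ∧ w = wordProd l}) :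
    x * u ∈ Subalgebra.toSubmodule D ⊔
      Submodule.span ℂ {w | ∃ l, IsAlt E (pairAlg A B) l ∧ w = wordProd l} := by
  set U := Subalgebra.toSubmodule D ⊔
      Submodule.span ℂ {w | ∃ l, IsAlt E (pairAlg A B) l ∧ w = wordProd l} with hU
  have hD : ∀ d ∈ D, d ∈ U := fun d hd => (le_sup_left : _ ≤ U) hd
  have hW : ∀ l, IsAlt E (pairAlg A B) l → wordProd l ∈ U := fun l hl =>
    (le_sup_right : _ ≤ U) (Submodule.subset_span ⟨l, hl, rfl⟩)
  have hcons : ∀ {f : Bool} {x : M}, x ∈ pairAlg A B f → ∀ l, IsAlt E (pairAlg A B) l →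
      (∀ q ∈ l.head?, f ≠ q.1) → x * wordProd l ∈ U := by
    intro f x hx l hl hh
    have h1 : (x - E x) * wordProd l ∈ U := hW ((f, x - E x) :: l) (isAlt_cons_iff.2
      ⟨sub_mem hx (pairAlg_base_le hDA hDB _ (hE.2.1 x)), hE.apply_sub_self x, hh, hl⟩)
    have h2 : E x * wordProd l ∈ U := by
      rcases l with _ | ⟨p, l⟩
      · simpa using hD _ (hE.2.1 x)
      · have hl' := isAlt_cons_iff.1 hl
        have := hW ((p.1, E x * p.2) :: l) (isAlt_cons_iff.2
          ⟨mul_mem (pairAlg_base_le hDA hDB _ (hE.2.1 x)) hl'.1,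
            by rw [hE.apply_mul_left (hE.2.1 x), hl'.2.1, mul_zero], hl'.2.2.1, hl'.2.2.2⟩)
        simpa [mul_assoc] using this
    have := add_mem h1 h2
    rwa [← add_mul, sub_add_cancel] at this
  have hword : ∀ l, IsAlt E (pairAlg A B) l → x * wordProd l ∈ U := by
    intro l hl
    rcases l with _ | ⟨⟨g, y⟩, l⟩
    · exact hcons hx [] hl (by simp)
    · by_cases hfg : f = g
      · subst hfg
        have hl' := isAlt_cons_iff.1 hl
        rw [wordProd_cons, ← mul_assoc]
        exact hcons (mul_mem hx hl'.1) l hl'.2.2.2 hl'.2.2.1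
      · exact hcons hx _ hl (by simpa using hfg)
  rw [hU] at hu
  obtain ⟨d, hd, w, hw, rfl⟩ := Submodule.mem_sup.1 hu
  rw [mul_add]
  refine add_mem ?_ ?_
  · have := hcons (mul_mem hx (pairAlg_base_le hDA hDB _ hd)) [] isAlt_nil (by simp)
    simpa using this
  · clear hu
    induction hw using Submodule.span_induction with
    | mem w h => obtain ⟨l, hl, rfl⟩ := h; exact hword l hl
    | zero => simp
    | add y z hy hz ihy ihz =>
      rw [mul_add]
      exact add_mem ihy ihz
    | smul c y hy ih =>
      rw [mul_smul_comm]
      exact U.smul_mem c ih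

/-- Every element of the algebra generated by `A` and `B` is the sum of an element of `A` and a
combination of alternating centered words containing a letter from `B`. -/
theorem sup_le_add_span_hasFalse (hE : IsCondExp D E) (hDA : D ≤ A) (hDB : D ≤ B) {w : M}
    (hw : w ∈ A ⊔ B) :
    ∃ a ∈ A, ∃ v ∈ Submodule.span ℂ
      {w | ∃ l, IsAlt E (pairAlg A B) l ∧ HasFalse l ∧ w = wordProd l}, w = a + v := by
  set U := Subalgebra.toSubmodule D ⊔
      Submodule.span ℂ {w | ∃ l, IsAlt E (pairAlg A B) l ∧ w = wordProd l} with hU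
  have hmul : ∀ u ∈ U, w * u ∈ U := by
    have hw' : w ∈ Algebra.adjoin ℂ ((A : Set M) ∪ B) := by
      rwa [Algebra.adjoin_union, Algebra.adjoin_eq, Algebra.adjoin_eq]
    clear hw
    induction hw' using Algebra.adjoin_induction with
    | mem x h =>
      intro u hu
      rcases h with h | h
      · exact mul_mem_altSpan (f := true) hE hDA hDB h hu
      · exact mul_mem_altSpan (f := false) hE hDA hDB h hu
    | algebraMap r =>
      intro u hu
      rw [← Algebra.smul_def]
      exact U.smul_mem _ hu
    | add x y hx hy ihx ihy => intro u hu; rw [add_mul]; exact add_mem (ihx u hu) (ihy u hu)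
    | mul x y hx hy ihx ihy => intro u hu; rw [mul_assoc]; exact ihx _ (ihy u hu)
  have hwU : w ∈ U := by
    have := hmul 1 ((le_sup_left : _ ≤ U) (one_mem D))
    rwa [mul_one] at this
  have hle : U ≤ Subalgebra.toSubmodule A ⊔ Submodule.span ℂ
      {w | ∃ l, IsAlt E (pairAlg A B) l ∧ HasFalse l ∧ w = wordProd l} := by
    refine sup_le (le_sup_of_le_left fun x hx => hDA hx) (Submodule.span_le.2 ?_)
    rintro _ ⟨l, hl, rfl⟩
    by_cases hf : HasFalse l
    · exact (le_sup_right : _ ≤ Subalgebra.toSubmodule A ⊔ Submodule.span ℂ _)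
        (Submodule.subset_span ⟨l, hl, hf, rfl⟩)
    · refine (le_sup_left : _ ≤ Subalgebra.toSubmodule A ⊔ Submodule.span ℂ _) ?_
      change (l.map Prod.snd).prod ∈ A
      refine list_prod_mem fun y hy => ?_
      obtain ⟨p, hp, rfl⟩ := List.mem_map.1 hy
      have := hl.mem p hp
      have hp1 : p.1 = true := by
        by_contra h
        exact hf ⟨p, hp, by simpa using h⟩
      rwa [hp1] at this
  obtain ⟨a, ha, v, hv, rfl⟩ := Submodule.mem_sup.1 (hle hwU)
  exact ⟨a, ha, v, hv, rfl⟩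

theorem star_wordProd_eq {l : List (Bool × M)} (hτ : IsFaithfulTracialState τ)
    (hD : ∀ d ∈ D, star d ∈ D) (hE : IsCondExp D E) (hEτ : ∀ x, τ (E x) = τ x)
    (hA : ∀ a ∈ A, star a ∈ A) (hB : ∀ b ∈ B, star b ∈ B)
    (hl : IsAlt E (pairAlg A B) l) (hf : HasFalse l) :
    ∃ l', IsAlt E (pairAlg A B) l' ∧ HasFalse l' ∧ star (wordProd l) = wordProd l' := by
  refine ⟨l.reverse.map fun p => (p.1, star p.2), ⟨?_, ?_, ?_⟩, ?_, ?_⟩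
  · intro q hq
    obtain ⟨p, hp, rfl⟩ := List.mem_map.1 hq
    have := hl.mem p (List.mem_reverse.1 hp)
    rcases p with ⟨_ | _, x⟩
    exacts [hB x this, hA x this]
  · intro q hq
    obtain ⟨p, hp, rfl⟩ := List.mem_map.1 hq
    exact IsCondExp.apply_star_eq_zero hτ hD hE hEτ (hl.centered p (List.mem_reverse.1 hp))
  · rw [List.isChain_map, List.isChain_reverse]
    exact hl.chain.imp fun p q h => h.symm
  · obtain ⟨p, hp, h⟩ := hf
    exact ⟨_, List.mem_map_of_mem (List.mem_reverse.2 hp), h⟩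
  · clear hl hf
    induction l with
    | nil => simp
    | cons p l ih => simp [ih]

end Amalgam

/-! ### Free difference quotients -/

section Derivation

open TensorProduct

variable {n : ℕ}

/-- `IsDiffQuot B Y w T` says that `T i` is a value of the `i`-th free difference quotient
relative to `B` on the element `w` of `B⟨Y₁, …, Yₙ⟩`. -/
inductive IsDiffQuot (B : Subalgebra ℂ M) (Y : Fin n → M) : M → (Fin n → M ⊗[ℂ] M) → Prop
  | base {b : M} (hb : b ∈ B) : IsDiffQuot B Y b 0
  | var (i : Fin n) : IsDiffQuot B Y (Y i) (Pi.single i (1 ⊗ₜ 1))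
  | add {x y : M} {S T : Fin n → M ⊗[ℂ] M} (hx : IsDiffQuot B Y x S)
      (hy : IsDiffQuot B Y y T) : IsDiffQuot B Y (x + y) (S + T)
  | mul {x y : M} {S T : Fin n → M ⊗[ℂ] M} (hx : IsDiffQuot B Y x S)
      (hy : IsDiffQuot B Y y T) :
      IsDiffQuot B Y (x * y) fun i => S i * (1 ⊗ₜ y) + (x ⊗ₜ 1) * T i

/-- Words in `Y` with coefficients in `B`, with their free difference quotients. -/
inductive IsDiffWord (B : Subalgebra ℂ M) (Y : Fin n → M) : M → (Fin n → M ⊗[ℂ] M) → Prop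
  | base {b : M} (hb : b ∈ B) : IsDiffWord B Y b 0
  | cons {b : M} (hb : b ∈ B) (i : Fin n) {w : M} {T : Fin n → M ⊗[ℂ] M}
      (hw : IsDiffWord B Y w T) :
      IsDiffWord B Y (b * Y i * w)
        (((b * Y i) ⊗ₜ[ℂ] (1 : M)) • T + Pi.single i (b ⊗ₜ w))

variable {B D : Subalgebra ℂ M} {Y : Fin n → M}

theorem IsDiffQuot.mono (h : D ≤ B) {w : M} {T : Fin n → M ⊗[ℂ] M}
    (hw : IsDiffQuot D Y w T) : IsDiffQuot B Y w T := by
  induction hw with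
  | base hb => exact .base (h hb)
  | var i => exact .var i
  | add _ _ ihx ihy => exact .add ihx ihy
  | mul _ _ ihx ihy => exact .mul ihx ihy

theorem exists_isDiffQuot {w : M} (hw : w ∈ polyAlg B Y) : ∃ T, IsDiffQuot B Y w T := by
  rw [polyAlg_eq_adjoin] at hw
  induction hw using Algebra.adjoin_induction with
  | mem x h =>
    rcases h with h | ⟨i, rfl⟩
    exacts [⟨_, .base h⟩, ⟨_, .var i⟩]
  | algebraMap r => exact ⟨_, .base (B.algebraMap_mem r)⟩
  | add x y _ _ ihx ihy =>
    obtain ⟨S, hS⟩ := ihx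
    obtain ⟨T, hT⟩ := ihy
    exact ⟨_, .add hS hT⟩
  | mul x y _ _ ihx ihy =>
    obtain ⟨S, hS⟩ := ihx
    obtain ⟨T, hT⟩ := ihy
    exact ⟨_, .mul hS hT⟩

theorem IsDiffQuot.mem_span {w : M} {T : Fin n → M ⊗[ℂ] M} (hw : IsDiffQuot B Y w T)
    (i : Fin n) :
    w ∈ polyAlg B Y ∧
      T i ∈ Submodule.span ℂ {t | ∃ x ∈ polyAlg B Y, ∃ y ∈ polyAlg B Y, t = x ⊗ₜ[ℂ] y} := by
  induction hw with
  | base hb => exact ⟨mem_polyAlg_base Y hb, by simp⟩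
  | var j =>
    refine ⟨mem_polyAlg_var B Y j, ?_⟩
    by_cases h : i = j
    · subst h
      rw [Pi.single_eq_same]
      exact Submodule.subset_span ⟨1, one_mem _, 1, one_mem _, rfl⟩
    · rw [Pi.single_eq_of_ne h]
      exact zero_mem _
  | add _ _ ihx ihy => exact ⟨add_mem ihx.1 ihy.1, add_mem ihx.2 ihy.2⟩
  | @mul x y S T _ _ ihx ihy =>
    refine ⟨mul_mem ihx.1 ihy.1, add_mem ?_ ?_⟩
    · obtain ⟨hx, ht⟩ := ihx
      revert ht
      generalize S i = t
      intro ht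
      induction ht using Submodule.span_induction with
      | mem t h =>
        obtain ⟨a, ha, b, hb, rfl⟩ := h
        rw [Algebra.TensorProduct.tmul_mul_tmul, mul_one]
        exact Submodule.subset_span ⟨_, ha, _, mul_mem hb ihy.1, rfl⟩
      | zero => simp
      | add s t _ _ hs ht => rw [add_mul]; exact add_mem hs ht
      | smul c t _ ht => rw [smul_mul_assoc]; exact Submodule.smul_mem _ c ht
    · obtain ⟨hy, ht⟩ := ihy
      revert ht
      generalize T i = t
      intro ht
      induction ht using Submodule.span_induction with
      | mem t h =>
        obtain ⟨a, ha, b, hb, rfl⟩ := h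
        rw [Algebra.TensorProduct.tmul_mul_tmul, one_mul]
        exact Submodule.subset_span ⟨_, mul_mem ihx.1 ha, _, hb, rfl⟩
      | zero => simp
      | add s t _ _ hs ht => rw [mul_add]; exact add_mem hs ht
      | smul c t _ ht => rw [mul_smul_comm]; exact Submodule.smul_mem _ c ht

theorem IsDiffWord.base_mul {b w : M} {T : Fin n → M ⊗[ℂ] M} (hb : b ∈ B)
    (hw : IsDiffWord B Y w T) :
    IsDiffWord B Y (b * w) ((b ⊗ₜ[ℂ] (1 : M)) • T) := by
  cases hw with
  | base hb' =>
    rw [smul_zero]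
    exact .base (mul_mem hb hb')
  | @cons b' hb' i w T hw =>
    convert IsDiffWord.cons (mul_mem hb hb') i hw using 1
    · simp [mul_assoc]
    · ext j
      by_cases h : j = i
      · subst h
        simp [mul_add, mul_assoc, ← mul_assoc (b ⊗ₜ[ℂ] (1 : M))]
      · simp [h, mul_assoc, ← mul_assoc (b ⊗ₜ[ℂ] (1 : M))]

theorem IsDiffWord.mul {x y : M} {S T : Fin n → M ⊗[ℂ] M} (hx : IsDiffWord B Y x S)
    (hy : IsDiffWord B Y y T) :
    IsDiffWord B Y (x * y) fun i => S i * (1 ⊗ₜ y) + (x ⊗ₜ 1) * T i := by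
  induction hx with
  | base hb =>
    convert hy.base_mul hb using 1
    ext j
    simp
  | @cons b hb i w S hw ih =>
    convert IsDiffWord.cons hb i ih using 1
    · simp [mul_assoc]
    · ext j
      simp only [Pi.add_apply, Pi.smul_apply, smul_eq_mul, mul_add, add_mul, Pi.single_apply]
      split_ifs
      · simp only [← mul_assoc, Algebra.TensorProduct.tmul_mul_tmul, mul_one]
        abel
      · simp only [← mul_assoc, Algebra.TensorProduct.tmul_mul_tmul, mul_one, zero_mul]
        abel

/-- The pairing `x ⊗ y ↦ τ x * τ y`. -/
def tensorTrace (τ : M →ₗ[ℂ] ℂ) : M ⊗[ℂ] M →ₗ[ℂ] ℂ :=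
  TensorProduct.lift ((LinearMap.mul ℂ ℂ).compl₁₂ τ τ)

@[simp] theorem tensorTrace_tmul (τ : M →ₗ[ℂ] ℂ) (x y : M) :
    tensorTrace τ (x ⊗ₜ y) = τ x * τ y := by simp [tensorTrace]

theorem altWord_cons (b : M) (i : Fin n) {m : ℕ} (c : Fin (m + 1) → M) (idx : Fin m → Fin n) :
    altWord Y (Fin.cons b c : Fin (m + 2) → M) (Fin.cons i idx : Fin (m + 1) → Fin n) =
      b * Y i * altWord Y c idx := by
  simp only [altWord, List.ofFn_succ, List.prod_cons, Fin.castSucc_zero, Fin.cons_zero,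
    ← Fin.succ_castSucc, Fin.cons_succ, ← Fin.succ_last, mul_assoc]

theorem altWordBefore_cons_zero (b : M) (i : Fin n) {m : ℕ} (c : Fin (m + 1) → M)
    (idx : Fin m → Fin n) :
    altWordBefore Y (Fin.cons b c : Fin (m + 2) → M) (Fin.cons i idx : Fin (m + 1) → Fin n) 0 =
      b := by
  simp [altWordBefore]

theorem altWordBefore_cons_succ (b : M) (i : Fin n) {m : ℕ} (c : Fin (m + 1) → M)
    (idx : Fin m → Fin n) (r : Fin m) :
    altWordBefore Y (Fin.cons b c : Fin (m + 2) → M) (Fin.cons i idx : Fin (m + 1) → Fin n)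
      r.succ = b * Y i * altWordBefore Y c idx r := by
  simp [altWordBefore, List.finRange_succ, List.filter_map, Function.comp_def, mul_assoc]

theorem altWordAfter_cons_zero (b : M) (i : Fin n) {m : ℕ} (c : Fin (m + 1) → M)
    (idx : Fin m → Fin n) :
    altWordAfter Y (Fin.cons b c : Fin (m + 2) → M) (Fin.cons i idx : Fin (m + 1) → Fin n) 0 =
      altWord Y c idx := by
  simp [altWordAfter, altWord, List.finRange_succ, List.filter_map, Function.comp_def,
    ← Fin.succ_last, List.ofFn_eq_map]

theorem altWordAfter_cons_succ (b : M) (i : Fin n) {m : ℕ} (c : Fin (m + 1) → M)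
    (idx : Fin m → Fin n) (r : Fin m) :
    altWordAfter Y (Fin.cons b c : Fin (m + 2) → M) (Fin.cons i idx : Fin (m + 1) → Fin n)
      r.succ = altWordAfter Y c idx r := by
  simp [altWordAfter, List.finRange_succ, List.filter_map, Function.comp_def,
    ← Fin.succ_last]

theorem IsDiffWord.exists_altWord {w : M} {T : Fin n → M ⊗[ℂ] M} (hw : IsDiffWord B Y w T) :
    ∃ (m : ℕ) (b : Fin (m + 1) → M) (idx : Fin m → Fin n), (∀ j, b j ∈ B) ∧
      w = altWord Y b idx ∧ ∀ i, T i = ∑ r, if idx r = i then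
        altWordBefore Y b idx r ⊗ₜ[ℂ] altWordAfter Y b idx r else 0 := by
  induction hw with
  | @base b hb => exact ⟨0, fun _ => b, Fin.elim0, fun _ => hb, by simp [altWord], by simp⟩
  | @cons b hb i w T hw ih =>
    obtain ⟨m, c, idx, hc, rfl, hT⟩ := ih
    refine ⟨m + 1, Fin.cons b c, Fin.cons i idx, ?_, (altWord_cons b i c idx).symm, ?_⟩
    · intro j
      refine Fin.cases hb hc j
    · intro k
      rw [Fin.sum_univ_succ]
      simp only [altWordBefore_cons_zero, altWordBefore_cons_succ, altWordAfter_cons_zero,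
        altWordAfter_cons_succ, Fin.cons_zero, Fin.cons_succ, Pi.add_apply, Pi.smul_apply,
        smul_eq_mul, hT, Finset.mul_sum, Pi.single_apply, eq_comm (a := k)]
      rw [add_comm]
      congr 1
      refine Finset.sum_congr rfl fun r _ => ?_
      split_ifs <;> simp

variable {τ : M →ₗ[ℂ] ℂ}

theorem ConjugateEquations.apply_isDiffWord {J : Fin n → M} (hJ : ConjugateEquations τ B Y J)
    {w : M} {T : Fin n → M ⊗[ℂ] M} (hw : IsDiffWord B Y w T) (i : Fin n) :
    τ (J i * w) = tensorTrace τ (T i) := by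
  obtain ⟨m, b, idx, hb, rfl, hT⟩ := hw.exists_altWord
  rw [hJ i m b idx hb, hT, map_sum]
  refine Finset.sum_congr rfl fun r _ => ?_
  split_ifs <;> simp

theorem IsDiffQuot.mem_span_isDiffWord {w : M} {T : Fin n → M ⊗[ℂ] M}
    (hw : IsDiffQuot B Y w T) :
    (w, T) ∈ Submodule.span ℂ {p : M × (Fin n → M ⊗[ℂ] M) | IsDiffWord B Y p.1 p.2} := by
  induction hw with
  | base hb => exact Submodule.subset_span (.base hb)
  | var i =>
    refine Submodule.subset_span ?_
    have h := IsDiffWord.cons (Y := Y) (one_mem B) i (.base (one_mem B))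
    simpa using h
  | add _ _ ihx ihy => exact add_mem ihx ihy
  | @mul x y S T _ _ ihx ihy =>
    let μ : (M × (Fin n → M ⊗[ℂ] M)) →ₗ[ℂ] (M × (Fin n → M ⊗[ℂ] M)) →ₗ[ℂ]
        (M × (Fin n → M ⊗[ℂ] M)) :=
      LinearMap.mk₂ ℂ
        (fun p q => (p.1 * q.1, fun i => p.2 i * (1 ⊗ₜ q.1) + (p.1 ⊗ₜ 1) * q.2 i))
        (by
          intro p p' q
          ext <;> simp [add_mul, add_tmul]
          abel)
        (by
          intro c p q
          ext
          · simp
          · simp [← smul_tmul'])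
        (by
          intro p q q'
          ext <;> simp [mul_add, tmul_add]
          abel)
        (by
          intro c p q
          ext <;> simp)
    change μ (x, S) (y, T) ∈ _
    have h := Submodule.apply_mem_map₂ μ ihx ihy
    rw [Submodule.map₂_span_span] at h
    refine Submodule.span_mono ?_ h
    rintro _ ⟨p, hp, q, hq, rfl⟩
    exact IsDiffWord.mul hp hq

/-- The conjugate equations, in terms of free difference quotients. -/
theorem ConjugateEquations.apply_mul {J : Fin n → M} (hJ : ConjugateEquations τ B Y J)
    {w : M} {T : Fin n → M ⊗[ℂ] M} (hw : IsDiffQuot B Y w T) (i : Fin n) :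
    τ (J i * w) = tensorTrace τ (T i) := by
  have h : ∀ p ∈ Submodule.span ℂ {p : M × (Fin n → M ⊗[ℂ] M) | IsDiffWord B Y p.1 p.2},
      τ (J i * p.1) = tensorTrace τ (p.2 i) := by
    intro p hp
    induction hp using Submodule.span_induction with
    | mem p hp => exact hJ.apply_isDiffWord hp i
    | zero => simp
    | add p q _ _ hp hq => simp [mul_add, hp, hq]
    | smul c p _ hp => simp [hp]
  exact h _ hw.mem_span_isDiffWord

end Derivation

/-! ### Freeness with amalgamation and conjugate variables -/

section Conjugate

open TensorProduct

variable {n : ℕ} {B D : Subalgebra ℂ M} {E : M →ₗ[ℂ] M} {τ : M →ₗ[ℂ] ℂ} {Y : Fin n → M}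

theorem exists_isDiffQuot_wordProd (hτ : IsFaithfulTracialState τ) (hDB : D ≤ B)
    (hE : IsCondExp D E) (hEτ : ∀ x, τ (E x) = τ x)
    (hF : WordFree E (pairAlg (polyAlg D Y) B)) (l l' : List (Bool × M))
    (hl : IsAlt E (pairAlg (polyAlg D Y) B) (l' ++ l)) (hf : HasFalse (l' ++ l)) :
    ∃ T, IsDiffQuot B Y (wordProd l) T ∧
      ∀ i, tensorTrace τ ((wordProd l' ⊗ₜ 1) * T i) = 0 := by
  have hDA : D ≤ polyAlg D Y := le_sup_left
  induction l generalizing l' with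
  | nil => exact ⟨0, .base (one_mem B), by simp⟩
  | cons p l ih =>
    obtain ⟨f, x⟩ := p
    have hassoc : l' ++ (f, x) :: l = (l' ++ [(f, x)]) ++ l := by simp
    obtain ⟨T, hT, hT0⟩ := ih (l' ++ [(f, x)]) (hassoc ▸ hl) (hassoc ▸ hf)
    have hl2 := isAlt_append_iff.1 hl
    have hl3 := isAlt_cons_iff.1 hl2.2.1
    have hT0' : ∀ i, tensorTrace τ ((wordProd l' ⊗ₜ 1) * ((x ⊗ₜ 1) * T i)) = 0 := by
      intro i
      rw [← hT0 i, ← mul_assoc, Algebra.TensorProduct.tmul_mul_tmul]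
      simp
    cases f
    · refine ⟨_, by simpa using IsDiffQuot.mul (.base hl3.1) hT, fun i => ?_⟩
      simpa using hT0' i
    · obtain ⟨S, hS⟩ := exists_isDiffQuot (B := D) (Y := Y) hl3.1
      refine ⟨_, by simpa using IsDiffQuot.mul (hS.mono hDB) hT, fun i => ?_⟩
      rw [mul_add, map_add, hT0', add_zero]
      have hff : HasFalse l' ∨ HasFalse l := by
        obtain ⟨q, hq, hqf⟩ := hf
        rcases List.mem_append.1 hq with h | h
        · exact Or.inl ⟨q, h, hqf⟩
        · rcases List.mem_cons.1 h with rfl | h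
          · simp at hqf
          · exact Or.inr ⟨q, h, hqf⟩
      have hSi := (hS.mem_span i).2
      revert hSi
      generalize S i = t
      intro ht
      induction ht using Submodule.span_induction with
      | mem t h =>
        obtain ⟨a, ha, b, hb, rfl⟩ := h
        rw [Algebra.TensorProduct.tmul_mul_tmul, Algebra.TensorProduct.tmul_mul_tmul,
          tensorTrace_tmul]
        rcases hff with h | h
        · have := hF.trace_mul_mul hτ hE hEτ hDA hDB hl2.1 h (one_mem _) ha
          rw [one_mul] at this
          rw [mul_one, this, zero_mul]
        · have := hF.trace_mul_mul hτ hE hEτ hDA hDB hl3.2.2.2 h hb (one_mem _)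
          rw [mul_one] at this
          rw [one_mul, this, mul_zero]
      | zero => simp
      | add s t _ _ hs ht => rw [add_mul, mul_add, map_add, hs, ht, add_zero]
      | smul c t _ ht => rw [smul_mul_assoc, mul_smul_comm, map_smul, ht, smul_zero]

/-- If `Y` is free from `B` over `D`, then the conjugate system relative to `B` is also the
conjugate system relative to `D`. -/
theorem IsConjugateSystem.of_wordFree (hτ : IsFaithfulTracialState τ)
    (hB : ∀ b ∈ B, star b ∈ B) (hD : ∀ d ∈ D, star d ∈ D) (hDB : D ≤ B)
    (hE : IsCondExp D E) (hEτ : ∀ x, τ (E x) = τ x) (hY : ∀ i, IsSelfAdjoint (Y i))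
    (hF : WordFree E (pairAlg (polyAlg D Y) B)) {J : Fin n → M}
    (hJ : IsConjugateSystem τ B Y J) : IsConjugateSystem τ D Y J := by
  have hDA : D ≤ polyAlg D Y := le_sup_left
  refine ⟨fun i ε hε => ?_, fun i m b idx hb => hJ.2 i m b idx fun j => hDB (hb j)⟩
  obtain ⟨c, hc, hcd⟩ := hJ.1 i ε hε
  rw [adjoin_union_star_eq hB hY] at hc
  have hle : polyAlg B Y ≤ polyAlg D Y ⊔ B := sup_le le_sup_right (le_sup_right.trans le_sup_left)
  have hc' := hle hc
  obtain ⟨a, ha, v, hv, rfl⟩ := sup_le_add_span_hasFalse hE hDA hDB hc'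
  rw [adjoin_union_star_eq hD hY]
  refine ⟨a, ha, lt_of_le_of_lt ?_ hcd⟩
  have horth : τ ((J i - a) * star v) = 0 := by
    clear hcd hc hc'
    induction hv using Submodule.span_induction with
    | mem w h =>
      obtain ⟨l, hl, hf, rfl⟩ := h
      obtain ⟨l', hl', hf', heq⟩ := star_wordProd_eq hτ hD hE hEτ
        (fun a ha => star_mem_polyAlg hD hY ha) hB hl hf
      obtain ⟨T, hT, hT0⟩ := exists_isDiffQuot_wordProd hτ hDB hE hEτ hF l' []
        (by simpa using hl') (by simpa using hf')
      have h1 := hJ.2.apply_mul hT i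
      have h2 := hT0 i
      rw [wordProd_nil, ← Algebra.TensorProduct.one_def, one_mul] at h2
      have h3 := hF.trace_mul_mul hτ hE hEτ hDA hDB hl' hf' ha (one_mem _)
      rw [mul_one] at h3
      rw [heq, sub_mul, map_sub, h1, h2, h3, sub_zero]
    | zero => simp
    | add y z hy hz ihy ihz =>
      rw [star_add, mul_add, map_add, ihy, ihz, add_zero]
    | smul c y hy ih => rw [star_smul, mul_smul_comm, map_smul, ih, smul_zero]
  have hexp : (J i - (a + v)) * star (J i - (a + v)) =
      (J i - a) * star (J i - a) - (J i - a) * star v - v * star (J i - a) + v * star v := by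
    simp only [star_sub, star_add]
    noncomm_ring
  unfold l2Dist
  apply Real.sqrt_le_sqrt
  rw [hexp, map_add, map_sub, map_sub, horth, hτ.apply_mul_star v, horth]
  simpa using hτ.re_apply_self_nonneg v

/-- The pairing `x ⊗ y ↦ τ (E x * y)`. -/
def condPairing (τ : M →ₗ[ℂ] ℂ) (E : M →ₗ[ℂ] M) : M ⊗[ℂ] M →ₗ[ℂ] ℂ :=
  TensorProduct.lift (((LinearMap.mul ℂ M).comp E).compr₂ τ)

@[simp] theorem condPairing_tmul (x y : M) :
    condPairing τ E (x ⊗ₜ y) = τ (E x * y) := by simp [condPairing]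

/-- The functional through which commutators of conjugate variables act on words. -/
def commPairing (τ : M →ₗ[ℂ] ℂ) (E : M →ₗ[ℂ] M) (Y : Fin n → M) (u v : M)
    (T : Fin n → M ⊗[ℂ] M) : ℂ :=
  ∑ i, (condPairing τ E ((u ⊗ₜ 1) * T i * (Y i ⊗ₜ v)) -
    condPairing τ E ((u ⊗ₜ Y i) * T i * (1 ⊗ₜ v)))

theorem commPairing_mul (u v x y : M) (S T : Fin n → M ⊗[ℂ] M) :
    commPairing τ E Y u v (fun i => S i * (1 ⊗ₜ y) + (x ⊗ₜ 1) * T i) =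
      commPairing τ E Y u (y * v) S + commPairing τ E Y (u * x) v T := by
  simp only [commPairing, ← Finset.sum_add_distrib]
  refine Finset.sum_congr rfl fun i _ => ?_
  simp only [mul_add, add_mul, map_add]
  have e1 : ∀ t : M ⊗[ℂ] M, (u ⊗ₜ[ℂ] (1 : M)) * (t * (1 ⊗ₜ y)) * (Y i ⊗ₜ v) =
      (u ⊗ₜ[ℂ] (1 : M)) * t * (Y i ⊗ₜ (y * v)) := fun t => by
    simp only [mul_assoc, Algebra.TensorProduct.tmul_mul_tmul, one_mul]
  have e2 : ∀ t : M ⊗[ℂ] M, (u ⊗ₜ[ℂ] Y i) * (t * (1 ⊗ₜ y)) * (1 ⊗ₜ v) =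
      (u ⊗ₜ[ℂ] Y i) * t * (1 ⊗ₜ (y * v)) := fun t => by
    simp only [mul_assoc, Algebra.TensorProduct.tmul_mul_tmul, one_mul]
  have e3 : ∀ t : M ⊗[ℂ] M, (u ⊗ₜ[ℂ] (1 : M)) * ((x ⊗ₜ 1) * t) * (Y i ⊗ₜ v) =
      ((u * x) ⊗ₜ[ℂ] (1 : M)) * t * (Y i ⊗ₜ v) := fun t => by
    simp only [← mul_assoc, Algebra.TensorProduct.tmul_mul_tmul, mul_one]
  have e4 : ∀ t : M ⊗[ℂ] M, (u ⊗ₜ[ℂ] Y i) * ((x ⊗ₜ 1) * t) * (1 ⊗ₜ v) =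
      ((u * x) ⊗ₜ[ℂ] Y i) * t * (1 ⊗ₜ v) := fun t => by
    simp only [← mul_assoc, Algebra.TensorProduct.tmul_mul_tmul, mul_one]
  rw [e1, e2, e3, e4]
  ring

theorem commPairing_of_isDiffQuot (hE : IsCondExp D E) {w : M} {T : Fin n → M ⊗[ℂ] M}
    (hw : IsDiffQuot D Y w T) (u v : M) :
    commPairing τ E Y u v T = τ (E (u * w) * v) - τ (E u * (w * v)) := by
  induction hw generalizing u v with
  | base hb => simp [commPairing, hE.apply_mul_right hb, mul_assoc]
  | var i =>
    rw [commPairing, Finset.sum_eq_single i]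
    · simp
    · intro j _ hj
      simp [hj]
    · simp
  | @add x y S T _ _ ihx ihy =>
    have : commPairing τ E Y u v (S + T) =
        commPairing τ E Y u v S + commPairing τ E Y u v T := by
      simp only [commPairing, Pi.add_apply, mul_add, add_mul, map_add, ← Finset.sum_add_distrib]
      refine Finset.sum_congr rfl fun i _ => ?_
      ring
    rw [this, ihx, ihy]
    simp only [mul_add, add_mul, map_add]
    ring
  | mul _ _ ihx ihy =>
    rw [commPairing_mul, ihx, ihy]
    simp only [mul_assoc]
    ring

theorem ConjugateEquations.apply_mul_mul {J : Fin n → M} (hJ : ConjugateEquations τ B Y J)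
    {a w b : M} {S T R : Fin n → M ⊗[ℂ] M} (ha : IsDiffQuot B Y a S)
    (hw : IsDiffQuot B Y w T) (hb : IsDiffQuot B Y b R) (i : Fin n) :
    τ (J i * (a * (w * b))) = tensorTrace τ (S i * (1 ⊗ₜ (w * b))) +
      tensorTrace τ ((a ⊗ₜ 1) * T i * (1 ⊗ₜ b)) + tensorTrace τ (((a * w) ⊗ₜ 1) * R i) := by
  rw [hJ.apply_mul (.mul ha (.mul hw hb)) i]
  simp only [mul_add, map_add, ← mul_assoc, Algebra.TensorProduct.tmul_mul_tmul, mul_one]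
  ring

theorem sum_dual_eq (hE : IsCondExp D E)
    (hEτ : ∀ x, τ (E x) = τ x) {m : ℕ} {p q : Fin m → M} (hp : ∀ k, p k ∈ D)
    (hpq : ∀ z ∈ D, z = ∑ k, τ (z * p k) • q k) (z y : M) :
    ∑ k, τ (z * p k) * τ (q k * y) = τ (E z * y) := by
  have h := hpq (E z) (hE.2.1 z)
  have h2 : ∀ k, τ (E z * p k) = τ (z * p k) := fun k => by
    rw [← hE.apply_mul_right (hp k), hEτ]
  simp only [h2] at h
  conv_rhs => rw [h]
  simp [Finset.sum_mul]

/-- The commutators of the conjugate variables with `Y`, averaged over `D`. -/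
theorem ConjugateEquations.trace_commutator (hτ : IsFaithfulTracialState τ)
    (hE : IsCondExp D E) (hDB : D ≤ B)
    (hEτ : ∀ x, τ (E x) = τ x) {m : ℕ} {p q : Fin m → M} (hp : ∀ k, p k ∈ D)
    (hq : ∀ k, q k ∈ D) (hpq : ∀ z ∈ D, z = ∑ k, τ (z * p k) • q k)
    {J : Fin n → M} (hJ : ConjugateEquations τ B Y J)
    {w : M} {T : Fin n → M ⊗[ℂ] M} (hw : IsDiffQuot B Y w T) :
    τ ((∑ i, ∑ k, q k * (J i * Y i - Y i * J i) * p k) * w) = commPairing τ E Y 1 1 T := by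
  rw [commPairing, Finset.sum_mul, map_sum]
  refine Finset.sum_congr rfl fun i _ => ?_
  have hk : ∀ k, τ (q k * (J i * Y i - Y i * J i) * p k * w) =
      tensorTrace τ (((Y i * p k) ⊗ₜ 1) * T i * (1 ⊗ₜ q k)) -
        tensorTrace τ ((p k ⊗ₜ 1) * T i * (1 ⊗ₜ (q k * Y i))) := by
    intro k
    have hpk := IsDiffQuot.base (Y := Y) (hDB (hp k))
    have hqk := IsDiffQuot.base (Y := Y) (hDB (hq k))
    have h1 := hJ.apply_mul_mul (.mul (.var i) hpk) hw hqk i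
    have h2 := hJ.apply_mul_mul hpk hw (.mul hqk (.var i)) i
    simp only [Pi.single_eq_same, Pi.zero_apply, zero_mul, mul_zero, add_zero, map_zero,
      zero_add, Algebra.TensorProduct.tmul_mul_tmul, one_mul, mul_one, tensorTrace_tmul,
      hτ.unital] at h1 h2
    have e1 : τ (q k * (J i * Y i - Y i * J i) * p k * w) =
        τ (J i * (Y i * p k * (w * q k))) - τ (J i * (p k * (w * (q k * Y i)))) := by
      rw [← map_sub]
      have : q k * (J i * Y i - Y i * J i) * p k * w =
          q k * (J i * (Y i * p k * w)) - (q k * Y i) * (J i * (p k * w)) := by noncomm_ring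
      rw [this, map_sub, hτ.tracial (q k), hτ.tracial (q k * Y i), ← map_sub]
      congr 1
      noncomm_ring
    rw [e1, h1, h2]
    simp only [mul_assoc]
    ring
  simp only [Finset.sum_mul, map_sum, hk, Finset.sum_sub_distrib]
  generalize T i = t
  congr 1
  · induction t using TensorProduct.induction_on with
    | zero => simp
    | tmul x y =>
      simp only [Algebra.TensorProduct.tmul_mul_tmul, one_mul, mul_one, tensorTrace_tmul,
        condPairing_tmul]
      rw [← sum_dual_eq hE hEτ hp hpq]
      refine Finset.sum_congr rfl fun k _ => ?_
      have h : τ (Y i * p k * x) = τ (x * Y i * p k) := by rw [hτ.tracial, mul_assoc]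
      rw [h, hτ.tracial y]
    | add s t hs ht =>
      simp only [mul_add, add_mul, map_add, Finset.sum_add_distrib, hs, ht]
  · induction t using TensorProduct.induction_on with
    | zero => simp
    | tmul x y =>
      simp only [Algebra.TensorProduct.tmul_mul_tmul, one_mul, mul_one, tensorTrace_tmul,
        condPairing_tmul]
      rw [← sum_dual_eq hE hEτ hp hpq]
      refine Finset.sum_congr rfl fun k _ => ?_
      rw [hτ.tracial y, hτ.tracial (p k), mul_assoc (q k)]
    | add s t hs ht =>
      simp only [mul_add, add_mul, map_add, Finset.sum_add_distrib, hs, ht]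

theorem commutator_average_eq_zero (hτ : IsFaithfulTracialState τ)
    (hD : ∀ d ∈ D, star d ∈ D) (hE : IsCondExp D E) (hDB : D ≤ B)
    (hEτ : ∀ x, τ (E x) = τ x) (hY : ∀ i, IsSelfAdjoint (Y i)) {m : ℕ} {p q : Fin m → M}
    (hp : ∀ k, p k ∈ D) (hq : ∀ k, q k ∈ D) (hpq : ∀ z ∈ D, z = ∑ k, τ (z * p k) • q k)
    {J : Fin n → M} (hJ : ConjugateEquations τ B Y J)
    (hJD : ∀ i, MemL2Closure τ ((D : Set M) ∪ Set.range Y) (J i)) :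
    (∑ i, ∑ k, q k * (J i * Y i - Y i * J i) * p k) = 0 := by
  set j := ∑ i, ∑ k, q k * (J i * Y i - Y i * J i) * p k with hj
  have hpoly : ∀ a ∈ polyAlg D Y, τ (j * a) = 0 := by
    intro a ha
    obtain ⟨T, hT⟩ := exists_isDiffQuot ha
    rw [hj, hJ.trace_commutator hτ hE hDB hEτ hp hq hpq (hT.mono hDB),
      commPairing_of_isDiffQuot hE hT]
    simp [hE.1, hEτ]
  have hpoly' : ∀ a ∈ polyAlg D Y, τ (a * star j) = 0 := by
    intro a ha
    rw [hτ.apply_mul_star, hpoly _ (star_mem_polyAlg hD hY ha), map_zero]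
  have hmove : ∀ i k x, τ (q k * (x * Y i - Y i * x) * p k * star j) =
      τ (x * (Y i * (p k * star j * q k) - p k * star j * q k * Y i)) := by
    intro i k x
    have : q k * (x * Y i - Y i * x) * p k * star j =
        q k * (x * (Y i * (p k * star j))) - (q k * Y i) * (x * (p k * star j)) := by
      noncomm_ring
    rw [this, map_sub, hτ.tracial (q k), hτ.tracial (q k * Y i), ← map_sub]
    congr 1
    noncomm_ring
  apply hτ.eq_zero_of_re
  have : τ (j * star j) = 0 := by
    nth_rewrite 1 [hj]
    simp only [Finset.sum_mul, map_sum]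
    refine Finset.sum_eq_zero fun i _ => Finset.sum_eq_zero fun k _ => ?_
    rw [hmove]
    refine (hJD i).apply_mul_eq_zero hτ fun a ha => ?_
    rw [adjoin_union_star_eq hD hY] at ha
    rw [← hmove]
    have hpk := mem_polyAlg_base Y (hp k)
    have hqk := mem_polyAlg_base Y (hq k)
    have hYi := mem_polyAlg_var D Y i
    exact hpoly' _ (mul_mem (mul_mem hqk (sub_mem (mul_mem ha hYi) (mul_mem hYi ha))) hpk)
  rw [this, Complex.zero_re]

theorem exists_isDiffQuot_commPairing_eq_zero (hE : IsCondExp D E) (hDB : D ≤ B) {N : ℕ}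
    (hN : ∀ l : List (Bool × M), l ≠ [] → l.length < N → IsAlt E (pairAlg (polyAlg D Y) B) l →
      E (wordProd l) = 0) (l l' : List (Bool × M)) (hl' : l' ≠ [])
    (hlen : (l' ++ l).length ≤ N) (hl : IsAlt E (pairAlg (polyAlg D Y) B) (l' ++ l))
    (hlast : ∀ p ∈ l.getLast?, p.1 = false) :
    ∃ T, IsDiffQuot B Y (wordProd l) T ∧ commPairing τ E Y (wordProd l') 1 T = 0 := by
  induction l generalizing l' with
  | nil => exact ⟨0, .base (one_mem B), by simp [commPairing]⟩
  | cons p l ih =>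
    obtain ⟨f, x⟩ := p
    have hassoc : l' ++ (f, x) :: l = (l' ++ [(f, x)]) ++ l := by simp
    obtain ⟨T, hT, hT0⟩ := ih (l' ++ [(f, x)]) (by simp) (hassoc ▸ hlen) (hassoc ▸ hl) (by
      intro p hp
      apply hlast
      rcases l with _ | ⟨r, l⟩
      · simp at hp
      · simpa using hp)
    rw [wordProd_append, wordProd_cons, wordProd_nil, mul_one] at hT0
    have hl2 := isAlt_append_iff.1 hl
    have hl3 := isAlt_cons_iff.1 hl2.2.1
    cases f
    · refine ⟨_, by simpa using IsDiffQuot.mul (.base hl3.1) hT, ?_⟩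
      have := commPairing_mul (τ := τ) (E := E) (Y := Y) (wordProd l') 1 x (wordProd l) 0 T
      simp only [Pi.zero_apply, zero_mul, zero_add] at this
      rw [this, hT0, add_zero]
      simp [commPairing]
    · obtain ⟨S, hS⟩ := exists_isDiffQuot (B := D) (Y := Y) hl3.1
      refine ⟨_, by simpa using IsDiffQuot.mul (hS.mono hDB) hT, ?_⟩
      have hne : l ≠ [] := by
        rintro rfl
        simpa using hlast (true, x) (by simp)
      have hpos := List.length_pos_iff.2 hne
      simp only [List.length_append, List.length_cons] at hlen
      rw [commPairing_mul, commPairing_of_isDiffQuot hE hS, hT0]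
      have h1 := hN (l' ++ [(true, x)]) (by simp) (by simp; omega)
        (isAlt_append_iff.1 (hassoc ▸ hl)).1
      rw [wordProd_append, wordProd_cons, wordProd_nil, mul_one] at h1
      have h2 := hN l' hl' (by omega) hl2.1
      simp [h1, h2]

/-- If the conjugate variables relative to `B` lie in `L²(D⟨Y⟩)`, then `Y` is free from `B`
with amalgamation over `D`. -/
theorem wordFree_of_conjugateEquations (hτ : IsFaithfulTracialState τ) [FiniteDimensional ℂ D]
    (hD : ∀ d ∈ D, star d ∈ D) (hE : IsCondExp D E) (hDB : D ≤ B)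
    (hEτ : ∀ x, τ (E x) = τ x) (hY : ∀ i, IsSelfAdjoint (Y i))
    {J : Fin n → M} (hJ : ConjugateEquations τ B Y J)
    (hJD : ∀ i, MemL2Closure τ ((D : Set M) ∪ Set.range Y) (J i)) :
    WordFree E (pairAlg (polyAlg D Y) B) := by
  have hDA : D ≤ polyAlg D Y := le_sup_left
  obtain ⟨m, p, q, hp, hq, hpq⟩ := exists_dual_families hτ hD
  have hcomm : ∀ w T, IsDiffQuot B Y w T → commPairing τ E Y 1 1 T = 0 := by
    intro w T hw
    rw [← hJ.trace_commutator hτ hE hDB hEτ hp hq hpq hw,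
      commutator_average_eq_zero hτ hD hE hDB hEτ hY hp hq hpq hJ hJD, zero_mul, map_zero]
  suffices H : ∀ N, ∀ l : List (Bool × M), l.length = N → l ≠ [] →
      IsAlt E (pairAlg (polyAlg D Y) B) l → E (wordProd l) = 0 from
    fun l hl hA => H _ l rfl hl hA
  intro N
  induction N using Nat.strong_induction_on with
  | _ N ih =>
  have hN : ∀ l : List (Bool × M), l ≠ [] → l.length < N →
      IsAlt E (pairAlg (polyAlg D Y) B) l → E (wordProd l) = 0 :=
    fun l hl hlt hA => ih _ hlt l rfl hl hA
  have htf : ∀ (x : M) (l : List (Bool × M)), l ≠ [] → l.length + 1 = N →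
      (∀ p ∈ l.getLast?, p.1 = false) →
      IsAlt E (pairAlg (polyAlg D Y) B) ((true, x) :: l) → τ (x * wordProd l) = 0 := by
    intro x l hl hlen hlast hA
    obtain ⟨T, hT, hT0⟩ := exists_isDiffQuot_commPairing_eq_zero (τ := τ) hE hDB hN l [(true, x)]
      (by simp) (by simp; omega) (by simpa using hA) hlast
    have hA' := isAlt_cons_iff.1 hA
    obtain ⟨S, hS⟩ := exists_isDiffQuot (B := D) (Y := Y) hA'.1
    have h := hcomm _ _ (IsDiffQuot.mul (hS.mono hDB) hT)
    have hx : E x = 0 := hA'.2.1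
    rw [commPairing_mul, commPairing_of_isDiffQuot hE hS] at h
    simp only [wordProd_cons, wordProd_nil, mul_one, one_mul] at h hT0
    rw [hT0, hx, hE.1] at h
    simpa using h
  intro l hlN hl hA
  refine wordFree_of_trace hτ hD hE hEτ hDA hDB hl hA fun l' hl'len hA' => ?_
  rw [hlN] at hl'len
  have hpos : 0 < N := hlN ▸ List.length_pos_iff.2 hl
  clear hA hl hlN l
  rcases l' with _ | ⟨⟨f, x⟩, l⟩
  · simp only [List.length_nil] at hl'len
    omega
  have hA1 := isAlt_cons_iff.1 hA'
  rcases List.eq_nil_or_concat l with rfl | ⟨mid, ⟨g, y⟩, rfl⟩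
  · have hx : E x = 0 := hA1.2.1
    simp [← hEτ x, hx]
  rw [List.concat_eq_append] at *
  have hA2 := isAlt_append_iff.1 hA1.2.2.2
  have hA3 := isAlt_cons_iff.1 hA2.2.1
  simp only [List.length_cons, List.length_append, List.length_nil] at hl'len
  have hrot : τ (wordProd ((f, x) :: (mid ++ [(g, y)]))) = τ (y * x * wordProd mid) := by
    simp only [wordProd_cons, wordProd_append, wordProd_nil, mul_one]
    rw [← mul_assoc, hτ.tracial, mul_assoc]
  by_cases hfg : f = g
  · subst hfg
    have hmid : mid ≠ [] := by
      rintro rfl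
      exact hA1.2.2.1 (f, y) (by simp) rfl
    have hmidE := hN mid hmid (by omega) hA2.1
    have hmem : y * x - E (y * x) ∈ pairAlg (polyAlg D Y) B f :=
      sub_mem (mul_mem hA3.1 hA1.1) (pairAlg_base_le hDA hDB f (hE.2.1 _))
    have h0 := hN ((f, y * x - E (y * x)) :: mid) (by simp) (by simp; omega)
      (isAlt_cons_iff.2 ⟨hmem, hE.apply_sub_self _, fun q hq => by
        refine hA1.2.2.1 q ?_
        rcases mid with _ | ⟨r, mid⟩
        · simp at hq
        · simpa using hq, hA2.1⟩)
    have h1 : E (E (y * x) * wordProd mid) = 0 := by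
      rw [hE.apply_mul_left (hE.2.1 _), hmidE, mul_zero]
    rw [wordProd_cons, sub_mul, map_sub, h1, sub_zero] at h0
    rw [hrot, ← hEτ, h0, map_zero]
  · cases f
    · have hg : g = true := by simpa using Ne.symm hfg
      subst hg
      have := htf y ((false, x) :: mid) (by simp) (by simp; omega) (fun r hr => by
        rcases List.eq_nil_or_concat mid with rfl | ⟨mid, s, rfl⟩
        · simp only [List.getLast?_singleton, Option.mem_def, Option.some.injEq] at hr
          rw [← hr]
        · have hs := hA2.2.2 s (by simp) (true, y) (by simp)
          simp only [List.concat_eq_append, ← List.cons_append, List.getLast?_append,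
            List.getLast?_singleton, Option.some_or, Option.mem_def, Option.some.injEq] at hr
          rw [← hr]
          simpa using hs)
        (isAlt_cons_iff.2 ⟨hA3.1, hA3.2.1, by simp, isAlt_cons_iff.2 ⟨hA1.1, hA1.2.1, fun r hr => by
          refine hA1.2.2.1 r ?_
          rcases mid with _ | ⟨s, mid⟩
          · simp at hr
          · simpa using hr, hA2.1⟩⟩)
      rw [hrot, mul_assoc]
      simpa using this
    · have hg : g = false := by simpa using Ne.symm hfg
      subst hg
      have := htf x (mid ++ [(false, y)]) (by simp) (by simp; omega) (by simp) hA'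
      simpa using this

end Conjugate

/-! ### Enlarging one algebra by free elements -/

section Association

variable {ι : Type*}

/-- Products of `τ`-centered letters from the algebras `P j`, `j ≠ o`, of which consecutive ones
either carry different labels or are separated by a `τ`-centered element of `A`; the index `i`
is the label of the first letter. -/
inductive IsCore (τ : M →ₗ[ℂ] ℂ) (P : ι → Subalgebra ℂ M) (o : ι) (A : Subalgebra ℂ M) :
    ι → M → Prop
  | single {i : ι} {x : M} : i ≠ o → x ∈ P i → τ x = 0 → IsCore τ P o A i x
  | cons {i j : ι} {x w : M} : i ≠ o → x ∈ P i → τ x = 0 → i ≠ j → IsCore τ P o A j w →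
      IsCore τ P o A i (x * w)
  | cons_base {i j : ι} {x z w : M} : i ≠ o → x ∈ P i → τ x = 0 → z ∈ A → τ z = 0 →
      IsCore τ P o A j w → IsCore τ P o A i (x * (z * w))

variable {τ : M →ₗ[ℂ] ℂ} {P : ι → Subalgebra ℂ M} {o : ι} {A B D A' N : Subalgebra ℂ M}
  {E : M →ₗ[ℂ] M}

theorem IsCore.ne {i : ι} {w : M} (h : IsCore τ P o A i w) : i ≠ o := by
  cases h <;> assumption

theorem IsCore.mono (hle : A ≤ B) {i : ι} {w : M} (h : IsCore τ P o A i w) :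
    IsCore τ P o B i w := by
  induction h with
  | single hi hx h0 => exact .single hi hx h0
  | cons hi hx h0 hij _ ih => exact .cons hi hx h0 hij ih
  | cons_base hi hx h0 hz hz0 _ ih => exact .cons_base hi hx h0 (hle hz) hz0 ih

theorem IsCore.mul_mul {i j : ι} {w w' z : M} (h : IsCore τ P o A i w)
    (h' : IsCore τ P o A j w') (hz : z ∈ A) (hz0 : τ z = 0) :
    IsCore τ P o A i (w * (z * w')) := by
  induction h with
  | single hi hx h0 => exact .cons_base hi hx h0 hz hz0 h'
  | cons hi hx h0 hij _ ih => rw [mul_assoc]; exact .cons hi hx h0 hij ih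
  | cons_base hi hx h0 hy hy0 _ ih =>
    rw [mul_assoc, mul_assoc]
    exact .cons_base hi hx h0 hy hy0 ih

theorem IsCore.exists_isAlt {i : ι} {w : M} (h : IsCore τ P o (P o) i w) :
    ∃ x l, IsAlt τ P ((i, x) :: l) ∧ w = wordProd ((i, x) :: l) := by
  induction h with
  | @single i x hi hx h0 => exact ⟨x, [], isAlt_cons_iff.2 ⟨hx, h0, by simp, isAlt_nil⟩, by simp⟩
  | @cons i j x w hi hx h0 hij _ ih =>
    obtain ⟨y, l, hl, rfl⟩ := ih
    exact ⟨x, _, isAlt_cons_iff.2 ⟨hx, h0, by simpa using hij, hl⟩, by simp⟩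
  | @cons_base i j x z w hi hx h0 hz hz0 hw ih =>
    obtain ⟨y, l, hl, rfl⟩ := ih
    exact ⟨x, (o, z) :: (j, y) :: l, isAlt_cons_iff.2 ⟨hx, h0, by simpa using hi,
      isAlt_cons_iff.2 ⟨hz, hz0, by simpa using hw.ne.symm, hl⟩⟩, by simp⟩

theorem apply_sub_smul_one (hτ : IsFaithfulTracialState τ) (x : M) : τ (x - τ x • 1) = 0 := by
  rw [map_sub, map_smul, hτ.unital, smul_eq_mul, mul_one, sub_self]

theorem IsCore.trace_mul (hτ : IsFaithfulTracialState τ) (hP : WordFree τ P) {i : ι} {w : M}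
    (h : IsCore τ P o (P o) i w) {x y : M} (hx : x ∈ P o) (hy : y ∈ P o) :
    τ (x * (w * y)) = 0 := by
  obtain ⟨u, l, hl, rfl⟩ := h.exists_isAlt
  rw [← mul_assoc, hτ.tracial, ← mul_assoc]
  have h0 := hP _ (by simp) hl
  have h1 := hP ((o, y * x - τ (y * x) • 1) :: (i, u) :: l) (by simp) (isAlt_cons_iff.2
    ⟨sub_mem (mul_mem hy hx) ((P o).smul_mem (one_mem _) _), apply_sub_smul_one hτ _,
      by simpa using h.ne.symm, hl⟩)
  rw [wordProd_cons, sub_mul, smul_mul_assoc, one_mul, map_sub, map_smul, h0, smul_zero,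
    sub_zero] at h1
  exact h1

/-- The span of the products `a * w * a'` with `w` a core and `a, a' ∈ A`. -/
def coreSpan (τ : M →ₗ[ℂ] ℂ) (P : ι → Subalgebra ℂ M) (o : ι) (A : Subalgebra ℂ M) :
    Submodule ℂ M :=
  Submodule.span ℂ {v | ∃ i w a a', IsCore τ P o A i w ∧ a ∈ A ∧ a' ∈ A ∧ v = a * (w * a')}

theorem mul_mem_coreSpan_of_base {x u : M} (hx : x ∈ A)
    (hu : u ∈ Subalgebra.toSubmodule A ⊔ coreSpan τ P o A) :
    x * u ∈ Subalgebra.toSubmodule A ⊔ coreSpan τ P o A := by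
  obtain ⟨a, ha, v, hv, rfl⟩ := Submodule.mem_sup.1 hu
  rw [mul_add]
  refine add_mem ((le_sup_left : Subalgebra.toSubmodule A ≤ _) (A.mul_mem hx ha))
    ((le_sup_right : coreSpan τ P o A ≤ _) ?_)
  clear hu
  induction hv using Submodule.span_induction with
  | mem v h =>
    obtain ⟨i, w, b, b', hw, hb, hb', rfl⟩ := h
    exact Submodule.subset_span ⟨i, w, x * b, b', hw, mul_mem hx hb, hb', by rw [mul_assoc]⟩
  | zero => simp
  | add y z hy hz ihy ihz => rw [mul_add]; exact add_mem ihy ihz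
  | smul c y hy ih => rw [mul_smul_comm]; exact Submodule.smul_mem _ c ih

theorem mul_mem_coreSpan (hτ : IsFaithfulTracialState τ) {i : ι} (hi : i ≠ o) {x u : M}
    (hx : x ∈ P i) (hu : u ∈ Subalgebra.toSubmodule A ⊔ coreSpan τ P o A) :
    x * u ∈ Subalgebra.toSubmodule A ⊔ coreSpan τ P o A := by
  set U := Subalgebra.toSubmodule A ⊔ coreSpan τ P o A with hU
  have hA : ∀ a ∈ A, a ∈ U := fun a ha => (le_sup_left : Subalgebra.toSubmodule A ≤ U) ha
  have hV : ∀ {j w a a'}, IsCore τ P o A j w → a ∈ A → a' ∈ A → a * (w * a') ∈ U :=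
    fun hw ha ha' => (le_sup_right : coreSpan τ P o A ≤ U)
      (Submodule.subset_span ⟨_, _, _, _, hw, ha, ha', rfl⟩)
  have hV1 : ∀ {j w a'}, IsCore τ P o A j w → a' ∈ A → w * a' ∈ U := fun hw ha' => by
    simpa using hV hw (one_mem A) ha'
  have hsplit : ∀ (y m : M), y ∈ P i → m ∈ U → (y - τ y • 1) * m ∈ U → y * m ∈ U := by
    intro y m _ hm h
    rw [sub_mul, smul_mul_assoc, one_mul] at h
    simpa using add_mem h (U.smul_mem (τ y) hm)
  have hcen : ∀ y ∈ P i, y - τ y • 1 ∈ P i := fun y hy =>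
    sub_mem hy ((P i).smul_mem (one_mem _) _)
  have h1 : ∀ y ∈ P i, ∀ a ∈ A, y * a ∈ U := fun y hy a ha =>
    hsplit y a hy (hA a ha) (hV1 (.single hi (hcen y hy) (apply_sub_smul_one hτ y)) ha)
  have h2 : ∀ y ∈ P i, ∀ {j w a}, IsCore τ P o A j w → i ≠ j → a ∈ A → y * (w * a) ∈ U := by
    intro y hy j w a hw hij ha
    refine hsplit y _ hy (hV1 hw ha) ?_
    rw [← mul_assoc]
    exact hV1 (.cons hi (hcen y hy) (apply_sub_smul_one hτ y) hij hw) ha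
  have h3 : ∀ y ∈ P i, ∀ {j w z a}, IsCore τ P o A j w → z ∈ A → τ z = 0 → a ∈ A →
      y * (z * (w * a)) ∈ U := by
    intro y hy j w z a hw hz hz0 ha
    refine hsplit y _ hy (hV hw hz ha) ?_
    have := hV1 (.cons_base hi (hcen y hy) (apply_sub_smul_one hτ y) hz hz0 hw) ha
    simpa [mul_assoc] using this
  have h4 : ∀ y ∈ P i, ∀ {j w a}, IsCore τ P o A j w → a ∈ A → y * (w * a) ∈ U := by
    intro y hy j w a hw ha
    by_cases hij : i = j
    · subst hij
      cases hw with
      | single _ hv _ => rw [← mul_assoc]; exact h1 _ (mul_mem hy hv) a ha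
      | cons _ hv _ hne hw' =>
        rw [mul_assoc, ← mul_assoc y]
        exact h2 _ (mul_mem hy hv) hw' hne ha
      | cons_base _ hv _ hz hz0 hw' =>
        rw [mul_assoc, mul_assoc, ← mul_assoc y]
        exact h3 _ (mul_mem hy hv) hw' hz hz0 ha
    · exact h2 y hy hw hij ha
  obtain ⟨a, ha, v, hv, rfl⟩ := Submodule.mem_sup.1 hu
  rw [mul_add]
  refine add_mem (h1 x hx a ha) ?_
  clear hu
  induction hv using Submodule.span_induction with
  | mem v h =>
    obtain ⟨j, w, b, b', hw, hb, hb', rfl⟩ := h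
    have e1 := h3 x hx hw (sub_mem hb (A.smul_mem (one_mem _) (τ b)))
      (apply_sub_smul_one hτ b) hb'
    have e2 := U.smul_mem (τ b) (h4 x hx hw hb')
    rw [sub_mul, mul_sub, smul_mul_assoc, one_mul, mul_smul_comm] at e1
    simpa using add_mem e1 e2
  | zero => simp
  | add y z hy hz ihy ihz => rw [mul_add]; exact add_mem ihy ihz
  | smul c y hy ih => rw [mul_smul_comm]; exact Submodule.smul_mem _ c ih

theorem adjoin_le_coreSpan (hτ : IsFaithfulTracialState τ) {x : M}
    (hx : x ∈ Algebra.adjoin ℂ ((A : Set M) ∪ {y | ∃ i, i ≠ o ∧ y ∈ P i})) :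
    x ∈ Subalgebra.toSubmodule A ⊔ coreSpan τ P o A := by
  suffices H : ∀ u ∈ Subalgebra.toSubmodule A ⊔ coreSpan τ P o A,
      x * u ∈ Subalgebra.toSubmodule A ⊔ coreSpan τ P o A by
    have := H 1 ((le_sup_left : Subalgebra.toSubmodule A ≤ _) (one_mem A))
    rwa [mul_one] at this
  induction hx using Algebra.adjoin_induction with
  | mem x h =>
    intro u hu
    rcases h with h | ⟨i, hi, h⟩
    · exact mul_mem_coreSpan_of_base h hu
    · exact mul_mem_coreSpan hτ hi h hu
  | algebraMap r =>
    intro u hu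
    rw [← Algebra.smul_def]
    exact Submodule.smul_mem _ _ hu
  | add x y hx hy ihx ihy => intro u hu; rw [add_mul]; exact add_mem (ihx u hu) (ihy u hu)
  | mul x y hx hy ihx ihy => intro u hu; rw [mul_assoc]; exact ihx _ (ihy u hu)

theorem condExp_coreSpan (hτ : IsFaithfulTracialState τ) (hD : ∀ d ∈ D, star d ∈ D)
    (hE : IsCondExp D E) (hEτ : ∀ x, τ (E x) = τ x) (hP : WordFree τ P) (hDA : D ≤ A)
    (hA : A ≤ P o) {v : M} (hv : v ∈ coreSpan τ P o A) : E v = 0 := by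
  induction hv using Submodule.span_induction with
  | mem v h =>
    obtain ⟨i, w, a, a', hw, ha, ha', rfl⟩ := h
    rw [IsCondExp.apply_eq_zero_iff hτ hD hE hEτ]
    intro d hd
    rw [← mul_assoc]
    exact (hw.mono hA).trace_mul hτ hP (hA (mul_mem (hDA hd) ha)) (hA ha')
  | zero => simp
  | add y z hy hz ihy ihz => rw [map_add, ihy, ihz, add_zero]
  | smul c y hy ih => rw [map_smul, ih, smul_zero]

/-- The terms in the expansion of an alternating word with labels `s`. -/
inductive IsExpansionTerm (τ : M →ₗ[ℂ] ℂ) (P : ι → Subalgebra ℂ M) (o : ι)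
    (A B : Subalgebra ℂ M) (E : M →ₗ[ℂ] M) : List Bool → M → Prop
  | pure {l : List (Bool × M)} : IsAlt E (pairAlg A B) l →
      IsExpansionTerm τ P o A B E (l.map Prod.fst) (wordProd l)
  | core {s : List Bool} {i : ι} {a w b : M} : a ∈ A → IsCore τ P o (P o) i w → b ∈ P o →
      IsExpansionTerm τ P o A B E (true :: s) (a * (w * b))
  | mixed {s : List Bool} {i : ι} {f : Bool} {x a w b : M} {l : List (Bool × M)} :
      IsAlt E (pairAlg A B) ((f, x) :: l) → HasFalse ((f, x) :: l) → a ∈ A →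
      IsCore τ P o (P o) i w → b ∈ P o →
      IsExpansionTerm τ P o A B E (f :: s) (wordProd ((f, x) :: l) * (a * (w * b)))

theorem wordProd_mem_of_le (hA : A ≤ N) (hB : B ≤ N) {l : List (Bool × M)}
    (hl : IsAlt E (pairAlg A B) l) : wordProd l ∈ N := by
  refine list_prod_mem fun y hy => ?_
  obtain ⟨⟨f, x⟩, hp, rfl⟩ := List.mem_map.1 hy
  have := hl.mem _ hp
  cases f
  exacts [hB this, hA this]

theorem IsExpansionTerm.letter_mul {s : List Bool} {m : M}
    (hm : IsExpansionTerm τ P o A B E s m) {f : Bool} {x : M}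
    (hx : x ∈ pairAlg A B f) (hx0 : E x = 0) (hf : ∀ g ∈ s.head?, f ≠ g) :
    IsExpansionTerm τ P o A B E (f :: s) (x * m) := by
  cases hm with
  | pure hl =>
    have h : IsAlt E (pairAlg A B) ((f, x) :: _) := isAlt_cons_iff.2 ⟨hx, hx0, fun q hq =>
      hf q.1 (by simp only [List.head?_map, Option.mem_def] at hq ⊢; simp [hq]), hl⟩
    simpa using IsExpansionTerm.pure (τ := τ) (P := P) (o := o) h
  | core ha hw hb =>
    have hf' : f = false := by simpa using hf true (by simp)
    subst hf'
    simpa using IsExpansionTerm.mixed (l := [])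
      (isAlt_cons_iff.2 ⟨hx, hx0, by simp, isAlt_nil⟩) ⟨_, List.mem_cons_self, rfl⟩ ha hw hb
  | mixed hl hh ha hw hb =>
    obtain ⟨p, hp, hpf⟩ := hh
    have := fun s => IsExpansionTerm.mixed (s := s)
      (isAlt_cons_iff.2 ⟨hx, hx0, by simpa using hf, hl⟩)
      ⟨p, List.mem_cons_of_mem _ hp, hpf⟩ ha hw hb
    simpa only [wordProd_cons, mul_assoc] using this _

theorem IsExpansionTerm.core_mul (hτ : IsFaithfulTracialState τ) (hE : IsCondExp D E)
    (hEτ : ∀ x, τ (E x) = τ x) (hDA : D ≤ A) (hDB : D ≤ B) (hA : A ≤ P o) (hB : B ≤ P o)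
    (hF : WordFree E (pairAlg A B)) {s : List Bool} {m : M}
    (hm : IsExpansionTerm τ P o A B E s m) {i : ι} {w a a' : M} (hw : IsCore τ P o A i w)
    (ha : a ∈ A) (ha' : a' ∈ A) (hf : ∀ g ∈ s.head?, true ≠ g) :
    IsExpansionTerm τ P o A B E (true :: s) (a * (w * a') * m) := by
  cases hm with
  | pure hl =>
    have := fun s => IsExpansionTerm.core (B := B) (E := E) (s := s) ha (hw.mono hA)
      (mul_mem (hA ha') (wordProd_mem_of_le hA hB hl))
    simpa [mul_assoc] using this _
  | core => exact absurd rfl (hf true (by simp))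
  | @mixed _ j f x c u b l hl hh hc hu hb =>
    have hz : τ (a' * wordProd ((f, x) :: l) * c) = 0 :=
      hF.trace_mul_mul hτ hE hEτ hDA hDB hl hh ha' hc
    have := IsExpansionTerm.core (B := B) (E := E) (s := f :: ‹List Bool›) ha
      ((hw.mono hA).mul_mul hu (mul_mem (mul_mem (hA ha') (wordProd_mem_of_le hA hB hl))
        (hA hc)) hz) hb
    simpa [mul_assoc] using this

theorem IsExpansionTerm.trace_eq_zero (hτ : IsFaithfulTracialState τ)
    (hEτ : ∀ x, τ (E x) = τ x) (hA : A ≤ P o) (hB : B ≤ P o) (hP : WordFree τ P)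
    (hF : WordFree E (pairAlg A B)) {s : List Bool} {m : M} (hs : s ≠ [])
    (hm : IsExpansionTerm τ P o A B E s m) : τ m = 0 := by
  cases hm with
  | pure hl => rw [← hEτ, hF _ (by simpa using hs) hl, map_zero]
  | core ha hw hb => exact hw.trace_mul hτ hP (hA ha) hb
  | mixed hl hh ha hw hb =>
    rw [← mul_assoc]
    exact hw.trace_mul hτ hP (mul_mem (wordProd_mem_of_le hA hB hl) (hA ha)) hb

theorem wordProd_mem_span_isExpansionTerm (hτ : IsFaithfulTracialState τ)
    (hD : ∀ d ∈ D, star d ∈ D) (hE : IsCondExp D E)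
    (hEτ : ∀ x, τ (E x) = τ x) (hDA : D ≤ A) (hDB : D ≤ B) (hA : A ≤ P o) (hB : B ≤ P o)
    (hP : WordFree τ P) (hF : WordFree E (pairAlg A B))
    (hA' : A' ≤ Algebra.adjoin ℂ ((A : Set M) ∪ {y | ∃ i, i ≠ o ∧ y ∈ P i}))
    {l : List (Bool × M)} (hl : IsAlt E (pairAlg A' B) l) :
    wordProd l ∈ Submodule.span ℂ {m | IsExpansionTerm τ P o A B E (l.map Prod.fst) m} := by
  induction l with
  | nil => exact Submodule.subset_span (.pure isAlt_nil)
  | cons p l ih =>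
    obtain ⟨f, x⟩ := p
    obtain ⟨hx, hx0, hh, hl'⟩ := isAlt_cons_iff.1 hl
    have hm := ih hl'
    have hh' : ∀ g ∈ (l.map Prod.fst).head?, f ≠ g := by
      intro g hg
      rw [List.head?_map, Option.mem_def, Option.map_eq_some_iff] at hg
      obtain ⟨q, hq, rfl⟩ := hg
      exact hh q hq
    rw [wordProd_cons, List.map_cons]
    have hspan : ∀ y : M, (∀ m, IsExpansionTerm τ P o A B E (l.map Prod.fst) m →
        y * m ∈ Submodule.span ℂ {m | IsExpansionTerm τ P o A B E (f :: l.map Prod.fst) m}) →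
        y * wordProd l ∈
          Submodule.span ℂ {m | IsExpansionTerm τ P o A B E (f :: l.map Prod.fst) m} := by
      intro y hy
      generalize wordProd l = u at hm
      induction hm using Submodule.span_induction with
      | mem v h => exact hy v h
      | zero => simp
      | add y z hy hz ihy ihz => rw [mul_add]; exact add_mem ihy ihz
      | smul c y hy ih => rw [mul_smul_comm]; exact Submodule.smul_mem _ c ih
    cases f
    · exact hspan x fun m hm => Submodule.subset_span (hm.letter_mul (f := false) hx hx0 hh')
    · obtain ⟨a, ha, v, hv, rfl⟩ := Submodule.mem_sup.1 (adjoin_le_coreSpan hτ (hA' hx))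
      have hv0 := condExp_coreSpan hτ hD hE hEτ hP hDA hA hv
      have ha0 : E a = 0 := by
        have h : E (a + v) = 0 := hx0
        rwa [map_add, hv0, add_zero] at h
      rw [add_mul]
      refine add_mem
        (hspan a fun m hm => Submodule.subset_span (hm.letter_mul (f := true) ha ha0 hh'))
        (hspan v fun m hm => ?_)
      clear hv0 hx hx0 hl hh
      induction hv using Submodule.span_induction with
      | mem v h =>
        obtain ⟨i, w, b, b', hw, hb, hb', rfl⟩ := h
        exact Submodule.subset_span
          (hm.core_mul hτ hE hEτ hDA hDB hA hB hF hw hb hb' hh')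
      | zero => simp
      | add y z hy hz ihy ihz => rw [add_mul]; exact add_mem ihy ihz
      | smul c y hy ih => rw [smul_mul_assoc]; exact Submodule.smul_mem _ c ih

/-- Freeness with amalgamation persists when one of the algebras is enlarged by algebras that
are free from everything else. -/
theorem WordFree.enlarge (hτ : IsFaithfulTracialState τ)
    (hD : ∀ d ∈ D, star d ∈ D) (hE : IsCondExp D E)
    (hEτ : ∀ x, τ (E x) = τ x) (hDA : D ≤ A) (hDB : D ≤ B) (hA : A ≤ P o) (hB : B ≤ P o)
    (hP : WordFree τ P) (hF : WordFree E (pairAlg A B)) (hDA' : D ≤ A')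
    (hA' : A' ≤ Algebra.adjoin ℂ ((A : Set M) ∪ {y | ∃ i, i ≠ o ∧ y ∈ P i})) :
    WordFree E (pairAlg A' B) := by
  intro l hl hlA
  refine wordFree_of_trace hτ hD hE hEτ hDA' hDB hl hlA fun l' hlen hl' => ?_
  have hmem := wordProd_mem_span_isExpansionTerm hτ hD hE hEτ hDA hDB hA hB hP hF hA' hl'
  have hne : l'.map Prod.fst ≠ [] := by
    rw [← List.length_pos_iff] at hl ⊢
    rwa [List.length_map, hlen]
  generalize wordProd l' = u at hmem
  induction hmem using Submodule.span_induction with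
  | mem m h => exact h.trace_eq_zero hτ hEτ hA hB hP hF hne
  | zero => simp
  | add y z hy hz ihy ihz => rw [map_add, ihy, ihz, add_zero]
  | smul c y hy ih => rw [map_smul, ih, smul_zero]

/-- Freeness of `X` from `B` over `D` passes to `X + s • S` for `S` free from `B⟨X⟩`. -/
theorem WordFree.perturb (hτ : IsFaithfulTracialState τ)
    (hD : ∀ d ∈ D, star d ∈ D) (hE : IsCondExp D E)
    (hEτ : ∀ x, τ (E x) = τ x) (hDB : D ≤ B) {n : ℕ} {X S : Fin n → M}
    (hS : WordFree τ (Fin.cons (polyAlg B X) (fun i => Algebra.adjoin ℂ {S i}) :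
      Fin (n + 1) → Subalgebra ℂ M))
    (hF : WordFree E (pairAlg (polyAlg D X) B)) (s : ℂ) :
    WordFree E (pairAlg (polyAlg D fun i => X i + s • S i) B) := by
  refine WordFree.enlarge (o := 0) hτ hD hE hEτ le_sup_left hDB
    (by simpa only [Fin.cons_zero] using polyAlg_mono hDB X)
    (by simp only [Fin.cons_zero]; exact le_sup_left) hS hF le_sup_left ?_
  refine sup_le (fun d hd => Algebra.subset_adjoin (Or.inl (mem_polyAlg_base X hd)))
    (Algebra.adjoin_le ?_)
  rintro _ ⟨i, rfl⟩
  have h1 : X i ∈ (polyAlg D X : Set M) := mem_polyAlg_var D X i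
  have h2 : S i ∈ {y | ∃ j : Fin (n + 1), j ≠ 0 ∧ y ∈ (Fin.cons (polyAlg B X)
      (fun i => Algebra.adjoin ℂ {S i}) : Fin (n + 1) → Subalgebra ℂ M) j} :=
    ⟨i.succ, Fin.succ_ne_zero i, by
      simp only [Fin.cons_succ]
      exact Algebra.self_mem_adjoin_singleton ℂ (S i)⟩
  exact Subalgebra.add_mem _ (Algebra.subset_adjoin (Set.mem_union_left _ h1))
    (Subalgebra.smul_mem _ (Algebra.subset_adjoin (Set.mem_union_right _ h2)) s)

end Association

/-! ### Passing to the limit along perturbations -/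

section Limit

/-- The polynomial paths `ℝ → M`. -/
def polyPath (M : Type*) [Ring M] [Algebra ℂ M] : Submodule ℂ (ℝ → M) :=
  Submodule.span ℂ {g | ∃ (k : ℕ) (m : M), g = fun s : ℝ => (s : ℂ) ^ k • m}

theorem monomial_mem_polyPath (k : ℕ) (m : M) :
    (fun s : ℝ => (s : ℂ) ^ k • m) ∈ polyPath M :=
  Submodule.subset_span ⟨k, m, rfl⟩

theorem const_mem_polyPath (m : M) : (fun _ : ℝ => m) ∈ polyPath M := by
  simpa using monomial_mem_polyPath 0 m

theorem mul_mem_polyPath {g h : ℝ → M} (hg : g ∈ polyPath M) (hh : h ∈ polyPath M) :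
    g * h ∈ polyPath M := by
  have := Submodule.mul_mem_mul hg hh
  rw [polyPath, Submodule.span_mul_span] at this
  refine Submodule.span_mono ?_ this
  rintro _ ⟨_, ⟨k, m, rfl⟩, _, ⟨k', m', rfl⟩, rfl⟩
  refine ⟨k + k', m * m', funext fun s => ?_⟩
  simp [smul_smul, pow_add, mul_comm]

theorem comp_mem_polyPath (E : M →ₗ[ℂ] M) {g : ℝ → M} (hg : g ∈ polyPath M) :
    (fun s => E (g s)) ∈ polyPath M := by
  induction hg using Submodule.span_induction with
  | mem g h =>
    obtain ⟨k, m, rfl⟩ := h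
    simpa using monomial_mem_polyPath k (E m)
  | zero => simpa using const_mem_polyPath (0 : M)
  | add g h _ _ ihg ihh => simp only [Pi.add_apply, map_add]; exact add_mem ihg ihh
  | smul c g _ ih => simp only [Pi.smul_apply, map_smul]; exact (polyPath M).smul_mem c ih

theorem continuous_comp_polyPath (φ : M →ₗ[ℂ] ℂ) {g : ℝ → M} (hg : g ∈ polyPath M) :
    Continuous fun s => φ (g s) := by
  induction hg using Submodule.span_induction with
  | mem g h =>
    obtain ⟨k, m, rfl⟩ := h
    simp only [map_smul, smul_eq_mul]
    fun_prop
  | zero => simpa using continuous_const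
  | add g h _ _ ihg ihh => simp only [Pi.add_apply, map_add]; exact ihg.add ihh
  | smul c g _ ih => simp only [Pi.smul_apply, map_smul]; exact continuous_const.mul ih

variable {n : ℕ} {D B : Subalgebra ℂ M} {E : M →ₗ[ℂ] M} {τ : M →ₗ[ℂ] ℂ} {X S : Fin n → M}

theorem exists_polyPath {x : M} (hx : x ∈ polyAlg D X) :
    ∃ g ∈ polyPath M, g 0 = x ∧ ∀ s : ℝ, g s ∈ polyAlg D fun i => X i + (s : ℂ) • S i := by
  rw [polyAlg_eq_adjoin] at hx
  induction hx using Algebra.adjoin_induction with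
  | mem x h =>
    rcases h with h | ⟨i, rfl⟩
    · exact ⟨_, const_mem_polyPath x, rfl, fun s => mem_polyAlg_base _ h⟩
    · refine ⟨(fun _ => X i) + fun s : ℝ => (s : ℂ) ^ 1 • S i,
        add_mem (const_mem_polyPath _) (monomial_mem_polyPath 1 _), by simp, fun s => ?_⟩
      simpa using mem_polyAlg_var D (fun i => X i + (s : ℂ) • S i) i
  | algebraMap r => exact ⟨_, const_mem_polyPath _, rfl, fun s => algebraMap_mem _ r⟩
  | add x y _ _ ihx ihy =>
    obtain ⟨g, hg, rfl, hg'⟩ := ihx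
    obtain ⟨h, hh, rfl, hh'⟩ := ihy
    exact ⟨g + h, add_mem hg hh, rfl, fun s => add_mem (hg' s) (hh' s)⟩
  | mul x y _ _ ihx ihy =>
    obtain ⟨g, hg, rfl, hg'⟩ := ihx
    obtain ⟨h, hh, rfl, hh'⟩ := ihy
    exact ⟨g * h, mul_mem_polyPath hg hh, rfl, fun s => mul_mem (hg' s) (hh' s)⟩

theorem exists_polyPath_letter (hE : IsCondExp D E) {f : Bool} {x : M}
    (hx : x ∈ pairAlg (polyAlg D X) B f) (hx0 : E x = 0) :
    ∃ g ∈ polyPath M, g 0 = x ∧ ∀ s : ℝ,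
      g s ∈ pairAlg (polyAlg D fun i => X i + (s : ℂ) • S i) B f ∧ E (g s) = 0 := by
  cases f
  · rw [pairAlg_false] at hx
    refine ⟨_, const_mem_polyPath x, rfl, fun s => ⟨?_, hx0⟩⟩
    rwa [pairAlg_false]
  · rw [pairAlg_true] at hx
    simp only [pairAlg_true]
    obtain ⟨g, hg, rfl, hg'⟩ := exists_polyPath (S := S) hx
    refine ⟨g - fun s => E (g s), sub_mem hg (comp_mem_polyPath E hg), by simp [hx0],
      fun s => ⟨sub_mem (hg' s) (mem_polyAlg_base _ (hE.2.1 _)), hE.apply_sub_self _⟩⟩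

theorem exists_polyPath_word (hE : IsCondExp D E) {l : List (Bool × M)}
    (hl : IsAlt E (pairAlg (polyAlg D X) B) l) :
    ∃ L : ℝ → List (Bool × M), L 0 = l ∧ (fun s => wordProd (L s)) ∈ polyPath M ∧
      ∀ s : ℝ, (L s).map Prod.fst = l.map Prod.fst ∧
        IsAlt E (pairAlg (polyAlg D fun i => X i + (s : ℂ) • S i) B) (L s) := by
  induction l with
  | nil => exact ⟨fun _ => [], rfl, const_mem_polyPath 1, fun s => ⟨rfl, isAlt_nil⟩⟩
  | cons p l ih =>
    obtain ⟨f, x⟩ := p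
    obtain ⟨hx, hx0, hh, hl'⟩ := isAlt_cons_iff.1 hl
    obtain ⟨L, hL0, hL, hLs⟩ := ih hl'
    obtain ⟨g, hg, hg0, hgs⟩ := exists_polyPath_letter (S := S) hE hx hx0
    refine ⟨fun s => (f, g s) :: L s, by simp [hL0, hg0],
      by simp only [wordProd_cons]; exact mul_mem_polyPath hg hL, fun s => ⟨by simp [(hLs s).1],
        isAlt_cons_iff.2 ⟨(hgs s).1, (hgs s).2, fun q hq => ?_, (hLs s).2⟩⟩⟩
    have h1 : q.1 ∈ ((L s).map Prod.fst).head? := by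
      rw [List.head?_map]
      exact Option.mem_map_of_mem _ hq
    rw [(hLs s).1, List.head?_map, Option.mem_def, Option.map_eq_some_iff] at h1
    obtain ⟨r, hr, hrq⟩ := h1
    exact hrq ▸ hh r hr

theorem WordFree.of_frequently (hτ : IsFaithfulTracialState τ)
    (hD : ∀ d ∈ D, star d ∈ D) (hE : IsCondExp D E) (hEτ : ∀ x, τ (E x) = τ x) (hDB : D ≤ B)
    (h : ∃ᶠ s : ℝ in nhds 0,
      WordFree E (pairAlg (polyAlg D fun i => X i + (s : ℂ) • S i) B)) :
    WordFree E (pairAlg (polyAlg D X) B) := by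
  intro l hl hlA
  refine wordFree_of_trace hτ hD hE hEτ le_sup_left hDB hl hlA fun l' hlen hl' => ?_
  obtain ⟨L, hL0, hL, hLs⟩ := exists_polyPath_word (S := S) hE hl'
  have hcont := continuous_comp_polyPath τ hL
  have := (isClosed_singleton (x := (0 : ℂ))).mem_of_frequently_of_tendsto
    (h.mono fun s hs => ?_) (hcont.tendsto 0)
  · simpa [hL0] using this
  · have hne : L s ≠ [] := by
      intro h0
      have h1 := congrArg List.length (hLs s).1
      rw [← List.length_pos_iff] at hl
      simp only [h0, List.map_nil, List.length_nil, List.length_map] at h1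
      omega
    rw [Set.mem_singleton_iff, ← hEτ, hs _ hne (hLs s).2, map_zero]

end Limit

/-! ### Free Fisher information and free entropy -/

section Fisher

variable {n : ℕ} {B D : Subalgebra ℂ M} {E : M →ₗ[ℂ] M} {τ : M →ₗ[ℂ] ℂ} {Y J K : Fin n → M}

theorem IsConjugateSystem.re_apply_self_eq_add (hτ : IsFaithfulTracialState τ)
    (hD : ∀ d ∈ D, star d ∈ D) (hDB : D ≤ B) (hY : ∀ i, IsSelfAdjoint (Y i))
    (hJ : IsConjugateSystem τ B Y J) (hK : IsConjugateSystem τ D Y K) (i : Fin n) :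
    (τ (J i * star (J i))).re =
      (τ (K i * star (K i))).re + (τ ((J i - K i) * star (J i - K i))).re := by
  have horth : τ (K i * star (J i - K i)) = 0 := by
    refine (hK.1 i).apply_mul_eq_zero hτ fun a ha => ?_
    rw [adjoin_union_star_eq hD hY] at ha
    obtain ⟨T, hT⟩ := exists_isDiffQuot (star_mem_polyAlg hD hY ha)
    rw [hτ.apply_mul_star, sub_mul, map_sub, hJ.2.apply_mul (hT.mono hDB) i,
      hK.2.apply_mul hT i, sub_self, map_zero]
  have horth' : τ ((J i - K i) * star (K i)) = 0 := by
    rw [hτ.apply_mul_star, horth, map_zero]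
  have hexp : J i * star (J i) = K i * star (K i) + K i * star (J i - K i) +
      (J i - K i) * star (K i) + (J i - K i) * star (J i - K i) := by
    simp only [star_sub]
    noncomm_ring
  rw [hexp, map_add, map_add, map_add, horth, horth']
  simp

theorem IsConjugateSystem.ext (hτ : IsFaithfulTracialState τ)
    (hB : ∀ b ∈ B, star b ∈ B) (hY : ∀ i, IsSelfAdjoint (Y i))
    (hJ : IsConjugateSystem τ B Y J) (hK : IsConjugateSystem τ B Y K) : J = K := by
  funext i
  have h1 := hJ.re_apply_self_eq_add hτ hB le_rfl hY hK i
  have h2 := hK.re_apply_self_eq_add hτ hB le_rfl hY hJ i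
  have h3 := hτ.re_apply_self_nonneg (J i - K i)
  have h4 := hτ.re_apply_self_nonneg (K i - J i)
  exact sub_eq_zero.1 (hτ.eq_zero_of_re (by linarith))

theorem IsConjugateSystem.phiStar_eq (hτ : IsFaithfulTracialState τ)
    (hB : ∀ b ∈ B, star b ∈ B) (hY : ∀ i, IsSelfAdjoint (Y i))
    (hJ : IsConjugateSystem τ B Y J) :
    phiStar τ B Y = ∑ i, ENNReal.ofReal (τ (J i * star (J i))).re := by
  have : {r : ℝ≥0∞ | ∃ J : Fin n → M, IsConjugateSystem τ B Y J ∧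
      r = ∑ i, ENNReal.ofReal ((τ (J i * star (J i))).re)} =
      {∑ i, ENNReal.ofReal (τ (J i * star (J i))).re} := by
    ext r
    constructor
    · rintro ⟨K, hK, rfl⟩
      rw [hK.ext hτ hB hY hJ, Set.mem_singleton_iff]
    · rintro rfl
      exact ⟨J, hJ, rfl⟩
  rw [phiStar, this, sInf_singleton]

theorem IsConjugateSystem.toReal_phiStar (hτ : IsFaithfulTracialState τ)
    (hB : ∀ b ∈ B, star b ∈ B) (hY : ∀ i, IsSelfAdjoint (Y i))
    (hJ : IsConjugateSystem τ B Y J) :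
    (phiStar τ B Y).toReal = ∑ i, (τ (J i * star (J i))).re := by
  rw [hJ.phiStar_eq hτ hB hY, ENNReal.toReal_sum fun _ _ => ENNReal.ofReal_ne_top]
  exact Finset.sum_congr rfl fun i _ => ENNReal.toReal_ofReal (hτ.re_apply_self_nonneg _)

theorem exists_isConjugateSystem (h : phiStar τ B Y ≠ ⊤) : ∃ J, IsConjugateSystem τ B Y J := by
  by_contra hne
  refine h (sInf_eq_top.2 ?_)
  rintro _ ⟨J, hJ, _⟩
  exact absurd ⟨J, hJ⟩ hne

theorem toReal_phiStar_le (hτ : IsFaithfulTracialState τ) (hB : ∀ b ∈ B, star b ∈ B)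
    (hD : ∀ d ∈ D, star d ∈ D) (hDB : D ≤ B) (hY : ∀ i, IsSelfAdjoint (Y i))
    (hBfin : phiStar τ B Y ≠ ⊤) (hDfin : phiStar τ D Y ≠ ⊤) :
    (phiStar τ D Y).toReal ≤ (phiStar τ B Y).toReal := by
  obtain ⟨J, hJ⟩ := exists_isConjugateSystem hBfin
  obtain ⟨K, hK⟩ := exists_isConjugateSystem hDfin
  rw [hJ.toReal_phiStar hτ hB hY, hK.toReal_phiStar hτ hD hY]
  refine Finset.sum_le_sum fun i _ => ?_
  rw [hJ.re_apply_self_eq_add hτ hD hDB hY hK i]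
  linarith [hτ.re_apply_self_nonneg (J i - K i)]

/-- If the free Fisher informations relative to `B` and `D` are finite and equal, then `Y` is
free from `B` over `D`. -/
theorem wordFree_of_toReal_phiStar_eq (hτ : IsFaithfulTracialState τ) [FiniteDimensional ℂ D]
    (hB : ∀ b ∈ B, star b ∈ B) (hD : ∀ d ∈ D, star d ∈ D) (hDB : D ≤ B)
    (hE : IsCondExp D E) (hEτ : ∀ x, τ (E x) = τ x) (hY : ∀ i, IsSelfAdjoint (Y i))
    (hBfin : phiStar τ B Y ≠ ⊤) (hDfin : phiStar τ D Y ≠ ⊤)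
    (h : (phiStar τ B Y).toReal = (phiStar τ D Y).toReal) :
    WordFree E (pairAlg (polyAlg D Y) B) := by
  obtain ⟨J, hJ⟩ := exists_isConjugateSystem hBfin
  obtain ⟨K, hK⟩ := exists_isConjugateSystem hDfin
  rw [hJ.toReal_phiStar hτ hB hY, hK.toReal_phiStar hτ hD hY,
    Finset.sum_congr rfl fun i _ => hJ.re_apply_self_eq_add hτ hD hDB hY hK i,
    Finset.sum_add_distrib, add_eq_left,
    Finset.sum_eq_zero_iff_of_nonneg fun i _ => hτ.re_apply_self_nonneg _] at h
  have hJK : J = K := funext fun i =>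
    sub_eq_zero.1 (hτ.eq_zero_of_re (h i (Finset.mem_univ i)))
  exact wordFree_of_conjugateEquations hτ hD hE hDB hEτ hY hJ.2 (hJK ▸ hK.1)

theorem phiStar_eq_of_wordFree (hτ : IsFaithfulTracialState τ)
    (hB : ∀ b ∈ B, star b ∈ B) (hD : ∀ d ∈ D, star d ∈ D) (hDB : D ≤ B)
    (hE : IsCondExp D E) (hEτ : ∀ x, τ (E x) = τ x) (hY : ∀ i, IsSelfAdjoint (Y i))
    (hBfin : phiStar τ B Y ≠ ⊤) (hF : WordFree E (pairAlg (polyAlg D Y) B)) :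
    phiStar τ B Y = phiStar τ D Y := by
  obtain ⟨J, hJ⟩ := exists_isConjugateSystem hBfin
  rw [hJ.phiStar_eq hτ hB hY, (hJ.of_wordFree hτ hB hD hDB hE hEτ hY hF).phiStar_eq hτ hD hY]

open MeasureTheory in
theorem chiStar_ne_bot {X S : Fin n → M} (h : chiStar τ B X S ≠ ⊥) :
    (∀ t ∈ Set.Ioi (0 : ℝ), phiStar τ B (fun i => X i + (Real.sqrt t : ℂ) • S i) ≠ ⊤) ∧
      IntegrableOn (fun t : ℝ => (n : ℝ) / (1 + t) -
        (phiStar τ B fun i => X i + (Real.sqrt t : ℂ) • S i).toReal) (Set.Ioi 0) ∧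
      chiStar τ B X S = (((1 / 2 : ℝ) * (∫ t in Set.Ioi (0 : ℝ), ((n : ℝ) / (1 + t) -
            (phiStar τ B fun i => X i + (Real.sqrt t : ℂ) • S i).toReal)) +
        (n / 2 : ℝ) * Real.log (2 * Real.pi * Real.exp 1) : ℝ) : EReal) := by
  rw [chiStar] at h ⊢
  split_ifs at h ⊢ with hc
  · exact ⟨hc.1, hc.2, rfl⟩
  · exact absurd rfl h

theorem chiStar_congr {X S : Fin n → M}
    (h : ∀ t ∈ Set.Ioi (0 : ℝ), phiStar τ B (fun i => X i + (Real.sqrt t : ℂ) • S i) =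
      phiStar τ D (fun i => X i + (Real.sqrt t : ℂ) • S i)) :
    chiStar τ B X S = chiStar τ D X S := by
  have h1 : Set.EqOn (fun t : ℝ => (n : ℝ) / (1 + t) -
        (phiStar τ B fun i => X i + (Real.sqrt t : ℂ) • S i).toReal)
      (fun t : ℝ => (n : ℝ) / (1 + t) -
        (phiStar τ D fun i => X i + (Real.sqrt t : ℂ) • S i).toReal) (Set.Ioi 0) :=
    fun t ht => by simp only [h t ht]
  have h2 : (∀ t ∈ Set.Ioi (0 : ℝ),
      phiStar τ B (fun i => X i + (Real.sqrt t : ℂ) • S i) ≠ ⊤) ↔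
      ∀ t ∈ Set.Ioi (0 : ℝ), phiStar τ D (fun i => X i + (Real.sqrt t : ℂ) • S i) ≠ ⊤ :=
    forall₂_congr fun t ht => by rw [h t ht]
  unfold chiStar
  rw [MeasureTheory.integrableOn_congr_fun h1 measurableSet_Ioi,
    MeasureTheory.setIntegral_congr_fun measurableSet_Ioi h1]
  simp only [h2]

open MeasureTheory in
theorem ae_toReal_phiStar_eq (hτ : IsFaithfulTracialState τ) (hB : ∀ b ∈ B, star b ∈ B)
    (hD : ∀ d ∈ D, star d ∈ D) (hDB : D ≤ B) {X S : Fin n → M}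
    (hY : ∀ t : ℝ, ∀ i, IsSelfAdjoint (X i + (Real.sqrt t : ℂ) • S i))
    (hχ : chiStar τ B X S ≠ ⊥) (h : chiStar τ B X S = chiStar τ D X S) :
    ∀ᵐ t ∂volume.restrict (Set.Ioi (0 : ℝ)),
      (phiStar τ B fun i => X i + (Real.sqrt t : ℂ) • S i).toReal =
        (phiStar τ D fun i => X i + (Real.sqrt t : ℂ) • S i).toReal := by
  obtain ⟨hB1, hB2, hB3⟩ := chiStar_ne_bot hχ
  obtain ⟨hD1, hD2, hD3⟩ := chiStar_ne_bot (h ▸ hχ)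
  rw [hB3, hD3, EReal.coe_eq_coe_iff, add_left_inj, mul_right_inj' (by norm_num)] at h
  have hle : ∀ᵐ t ∂volume.restrict (Set.Ioi (0 : ℝ)), (n : ℝ) / (1 + t) -
        (phiStar τ B fun i => X i + (Real.sqrt t : ℂ) • S i).toReal ≤ (n : ℝ) / (1 + t) -
        (phiStar τ D fun i => X i + (Real.sqrt t : ℂ) • S i).toReal := by
    filter_upwards [ae_restrict_mem measurableSet_Ioi] with t ht
    exact sub_le_sub_left
      (toReal_phiStar_le hτ hB hD hDB (hY t) (hB1 t ht) (hD1 t ht)) _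
  filter_upwards [(integral_eq_iff_of_ae_le hB2 hD2 hle).1 h] with t ht
  simpa using ht

end Fisher

theorem frequently_sqrt_of_ae {p : ℝ → Prop}
    (h : ∀ᵐ t ∂MeasureTheory.volume.restrict (Set.Ioi (0 : ℝ)), p (√t)) :
    ∃ᶠ s : ℝ in nhds 0, p s := by
  have h1 : ∃ᶠ t : ℝ in nhds 0, p (√t) := by
    rw [Filter.frequently_iff]
    intro U hU
    obtain ⟨ε, hε, hεU⟩ := Metric.mem_nhds_iff.1 hU
    have h2 : ∀ᵐ t ∂MeasureTheory.volume.restrict (Set.Ioo 0 ε), p (√t) :=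
      MeasureTheory.ae_restrict_of_ae_restrict_of_subset Set.Ioo_subset_Ioi_self h
    have hne : (MeasureTheory.ae (MeasureTheory.volume.restrict (Set.Ioo 0 ε))).NeBot := by
      rw [MeasureTheory.ae_neBot, Ne, MeasureTheory.Measure.restrict_eq_zero, Real.volume_Ioo]
      simpa using hε
    obtain ⟨t, ht, ht'⟩ :=
      (h2.and (MeasureTheory.ae_restrict_mem measurableSet_Ioo)).exists
    refine ⟨t, hεU ?_, ht⟩
    rw [Metric.mem_ball, Real.dist_eq, sub_zero, abs_lt]
    exact ⟨by linarith [ht'.1], ht'.2⟩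
  have h2 : Filter.Tendsto (fun t : ℝ => √t) (nhds 0) (nhds 0) := by
    simpa using Real.continuous_sqrt.tendsto 0
  exact h2.frequently h1

theorem isSelfAdjoint_add_real_smul {x y : M} (hx : IsSelfAdjoint x) (hy : IsSelfAdjoint y)
    (s : ℝ) : IsSelfAdjoint (x + (s : ℂ) • y) :=
  hx.add (IsSelfAdjoint.smul (Complex.conj_ofReal s) hy)

theorem free_entropies_equal_iff_free
    (τ : M →ₗ[ℂ] ℂ) (hτ : IsFaithfulTracialState τ)
    (B : Subalgebra ℂ M) (hBstar : ∀ b ∈ B, star b ∈ B)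
    (D : Subalgebra ℂ M) (hDB : D ≤ B) [FiniteDimensional ℂ ↥D]
    (hDstar : ∀ d ∈ D, star d ∈ D)
    (ED : M →ₗ[ℂ] M) (hED : IsCondExp D ED) (hEDτ : ∀ x, τ (ED x) = τ x)
    {n : ℕ} (X : Fin n → M) (hX : ∀ i, IsSelfAdjoint (X i))
    -- the auxiliary free `(0,1)`-semicircular family used to define `χ*`
    (S : Fin n → M) (hS : ∀ i, IsStandardSemicircular τ (S i))
    (hSfree : IsFreeFamily τ
      (Fin.cons (B ⊔ Algebra.adjoin ℂ (Set.range X))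
        (fun i => Algebra.adjoin ℂ {S i}) : Fin (n + 1) → Subalgebra ℂ M))
    (hχ : chiStar τ B X S ≠ ⊥) :
    (chiStar τ B X S = chiStar τ D X S ↔
      IsFreeWithAmalgamation ED
        ((D ⊔ Algebra.adjoin ℂ (Set.range X) : Subalgebra ℂ M) : Set M)
        (B : Set M)) := by
  have hY : ∀ t : ℝ, ∀ i, IsSelfAdjoint (X i + (Real.sqrt t : ℂ) • S i) := fun t i =>
    isSelfAdjoint_add_real_smul (hX i) (hS i).1 _
  rw [isFreeWithAmalgamation_iff]
  constructor
  · intro h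
    refine WordFree.of_frequently (S := S) hτ hDstar hED hEDτ hDB (frequently_sqrt_of_ae ?_)
    filter_upwards [ae_toReal_phiStar_eq hτ hBstar hDstar hDB hY hχ h,
      MeasureTheory.ae_restrict_mem measurableSet_Ioi] with t ht ht0
    exact wordFree_of_toReal_phiStar_eq hτ hBstar hDstar hDB hED hEDτ (hY t)
      ((chiStar_ne_bot hχ).1 t ht0) ((chiStar_ne_bot (h ▸ hχ)).1 t ht0) ht
  · intro h
    exact chiStar_congr fun t ht => phiStar_eq_of_wordFree hτ hBstar hDstar hDB hED hEDτ (hY t)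
      ((chiStar_ne_bot hχ).1 t ht)
      (WordFree.perturb hτ hDstar hED hEDτ hDB (wordFree_iff_ofFn.2 hSfree) h _)

end OVD
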